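/- There is a homotopy equivalence $\Sigma K_n \simeq S^2 \vee \bigvee_{\text{even } i > 0} \binom{n-1}{i}\,(S^{i+1} \vee S^{i+2}) \vee \bigvee_{\text{odd } i \ge 1} \binom{n-1}{i}\, M^{i+2}(2)$, where the indices $i$ range over $1 \le i \le n-1$, $\binom{n-1}{i} X$ denotes a wedge of $\binom{n-1}{i}$ copies of $X$, and $M^{i+2}(2) = S^{i+1} \cup_2 e^{i+2}$ is the mod-2 Moore space. In particular, the suspension of $K_n$ is homotopy equivalent to a wedge of spheres and mod-2 Moore spaces. -/

import Mathlib

noncomputable section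

/-- Complex conjugation on the unit circle. -/
def Circle.conj (z : Circle) : Circle :=
  ⟨starRingEnd ℂ z, by
    have := z.2
    simp only [Submonoid.unitSphere, Submonoid.mem_mk, Subsemigroup.mem_mk] at *
    simp_all [mem_sphere_zero_iff_norm]⟩

/-- Negation on the unit circle. -/
def Circle.neg (z : Circle) : Circle :=
  ⟨-(z : ℂ), by
    have := z.2
    simp only [Submonoid.unitSphere, Submonoid.mem_mk, Subsemigroup.mem_mk] at *
    simp_all [mem_sphere_zero_iff_norm]⟩

/-- The torus `(S¹)ⁿ`. -/
abbrev Torus (n : ℕ) : Type := Fin n → Circle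

/-- The involution `(z₁,…,z_{n-1},z_n) ↦ (z̄₁,…,z̄_{n-1},-z_n)` on the torus. -/
def kleinInvolution (n : ℕ) (z : Torus n) : Torus n :=
  fun i => if (i : ℕ) + 1 = n then (z i).neg else (z i).conj

/-- The identification defining the `n`-dimensional Klein bottle. -/
def KleinRel (n : ℕ) (z w : Torus n) : Prop := w = kleinInvolution n z

/-- The `n`-dimensional Klein bottle `Kₙ = (S¹)ⁿ/((z,z_n) ∼ (z̄,-z_n))`. -/
def Klein (n : ℕ) : Type := Quot (KleinRel n)

instance (n : ℕ) : TopologicalSpace (Klein n) := instTopologicalSpaceQuot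

noncomputable section

open unitInterval

/-- Generating relation for the reduced suspension of `(X, x₀)`: collapse
`X × {0}`, `X × {1}` and `{x₀} × I`. -/
def SuspRel {X : Type} (x₀ : X) (p q : X × unitInterval) : Prop :=
  (p.2 = 0 ∧ q.2 = 0) ∨ (p.2 = 1 ∧ q.2 = 1) ∨ (p.1 = x₀ ∧ q.1 = x₀)

/-- The reduced suspension `ΣX` of a pointed space. -/
def Susp (X : Type) [TopologicalSpace X] (x₀ : X) : Type := Quot (SuspRel x₀)

instance (X : Type) [TopologicalSpace X] (x₀ : X) : TopologicalSpace (Susp X x₀) :=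
  instTopologicalSpaceQuot

/-- Basepoint of the reduced suspension. -/
def suspPt (X : Type) [TopologicalSpace X] (x₀ : X) : Susp X x₀ :=
  Quot.mk _ (x₀, 0)

/-- Generating relation for the reduced mapping cone of `φ : (A,a₀) → (B,b₀)`:
in `(A × I) ⊔ B`, collapse `A × {0}` and `{a₀} × I`, and glue `(a,1)` to `φ(a)`. -/
def ConeRel {A B : Type} (a₀ : A) (φ : A → B) :
    (A × unitInterval) ⊕ B → (A × unitInterval) ⊕ B → Prop
  | .inl p, .inl q => (p.2 = 0 ∧ q.2 = 0) ∨ (p.1 = a₀ ∧ q.1 = a₀)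
  | .inl p, .inr b => p.2 = 1 ∧ b = φ p.1
  | .inr _, _ => False

/-- The reduced mapping cone `MC(φ) = B ∪_φ CA` of a map `φ : (A,a₀) → (B,b₀)`. -/
def MCone {A B : Type} [TopologicalSpace A] [TopologicalSpace B] (a₀ : A) (φ : A → B) :
    Type := Quot (ConeRel a₀ φ)

instance {A B : Type} [TopologicalSpace A] [TopologicalSpace B] (a₀ : A) (φ : A → B) :
    TopologicalSpace (MCone a₀ φ) := instTopologicalSpaceQuot

/-- Basepoint of the mapping cone (the basepoint of `B`). -/
def mconePt {A B : Type} [TopologicalSpace A] [TopologicalSpace B] (a₀ : A) (φ : A → B)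
    (b₀ : B) : MCone a₀ φ := Quot.mk _ (Sum.inr b₀)

/-- Generating relation for the wedge `X ∨ Y`: identify the two basepoints. -/
def WedgeRel {X Y : Type} (x₀ : X) (y₀ : Y) : X ⊕ Y → X ⊕ Y → Prop :=
  fun p q => p = Sum.inl x₀ ∧ q = Sum.inr y₀

/-- The wedge (one-point union) `X ∨ Y` of two pointed spaces. -/
def Wedge (X Y : Type) [TopologicalSpace X] [TopologicalSpace Y] (x₀ : X) (y₀ : Y) : Type :=
  Quot (WedgeRel x₀ y₀)

instance (X Y : Type) [TopologicalSpace X] [TopologicalSpace Y] (x₀ : X) (y₀ : Y) :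
    TopologicalSpace (Wedge X Y x₀ y₀) := instTopologicalSpaceQuot

/-- Basepoint of the wedge. -/
def wedgePt (X Y : Type) [TopologicalSpace X] [TopologicalSpace Y] (x₀ : X) (y₀ : Y) :
    Wedge X Y x₀ y₀ := Quot.mk _ (Sum.inl x₀)

/-- Pointed homotopy equivalence of pointed spaces. -/
def PtdHomotopyEquiv (X Y : Type) [TopologicalSpace X] [TopologicalSpace Y]
    (x₀ : X) (y₀ : Y) : Prop :=
  ∃ (f : C(X, Y)) (g : C(Y, X)), f x₀ = y₀ ∧ g y₀ = x₀ ∧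
    (g.comp f).HomotopicRel (ContinuousMap.id X) {x₀} ∧
    (f.comp g).HomotopicRel (ContinuousMap.id Y) {y₀}

/-- Generating relation for the mapping torus of `h : W → W`:
glue `(w,0)` to `(h(w),1)` in `W × I`. -/
def MappingTorusRel {W : Type} (h : W → W) (p q : W × unitInterval) : Prop :=
  p.2 = 0 ∧ q.1 = h p.1 ∧ q.2 = 1

/-- The mapping torus `(W × I)/((w,0) ∼ (h(w),1))`. -/
def MappingTorus {W : Type} [TopologicalSpace W] (h : W → W) : Type :=
  Quot (MappingTorusRel h)

instance {W : Type} [TopologicalSpace W] (h : W → W) :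
    TopologicalSpace (MappingTorus h) := instTopologicalSpaceQuot

/-- The 2-sphere, as the unit sphere of `ℝ³`. -/
def TwoSphere : Type := Metric.sphere (0 : EuclideanSpace ℝ (Fin 3)) 1

instance : TopologicalSpace TwoSphere := by unfold TwoSphere; infer_instance

/-- Basepoint of the 2-sphere. -/
def twoSpherePt : TwoSphere :=
  ⟨EuclideanSpace.single 0 1, by simp [EuclideanSpace.norm_single]⟩

/-- A bundled pointed topological space. -/
structure PtdSpace where
  carrier : Type
  [top : TopologicalSpace carrier]
  pt : carrier

attribute [instance] PtdSpace.top

/-- Reduced suspension of a bundled pointed space. -/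
def PtdSpace.susp (X : PtdSpace) : PtdSpace :=
  { carrier := Susp X.carrier X.pt, pt := suspPt X.carrier X.pt }

/-- The suspension of a pointed map. -/
def suspMap {X Y : Type} [TopologicalSpace X] [TopologicalSpace Y] (x₀ : X) (y₀ : Y)
    (f : X → Y) (hf : f x₀ = y₀) : Susp X x₀ → Susp Y y₀ :=
  Quot.lift (fun p => Quot.mk _ (f p.1, p.2)) (by
    rintro p q (⟨h1, h2⟩ | ⟨h1, h2⟩ | ⟨h1, h2⟩) <;> apply Quot.sound
    · exact Or.inl ⟨h1, h2⟩
    · exact Or.inr (Or.inl ⟨h1, h2⟩)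
    · exact Or.inr (Or.inr ⟨by rw [h1, hf], by rw [h2, hf]⟩))

/-- The sphere `S^{m+1}`, as the `m`-fold reduced suspension of the circle. -/
def SphP : ℕ → PtdSpace
  | 0 => { carrier := Circle, pt := 1 }
  | m + 1 => (SphP m).susp

/-- A degree-2 self-map of `S^{m+1}`: the `m`-fold suspension of `z ↦ z²` on the circle. -/
def degTwo : (m : ℕ) → {f : (SphP m).carrier → (SphP m).carrier // f (SphP m).pt = (SphP m).pt}
  | 0 => ⟨(fun z => z * z : Circle → Circle), by show (1 : Circle) * 1 = 1; simp⟩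
  | m + 1 =>
    ⟨suspMap (SphP m).pt (SphP m).pt (degTwo m).1 (degTwo m).2, by
      show Quot.mk _ ((degTwo m).1 (SphP m).pt, (0 : unitInterval)) =
        Quot.mk _ ((SphP m).pt, (0 : unitInterval))
      rw [(degTwo m).2]⟩

/-- The mod-2 Moore space `M^{m+2}(2) = S^{m+1} ∪₂ e^{m+2}`, as the mapping cone of a
degree-2 self-map of `S^{m+1}`. -/
def MooreP (m : ℕ) : PtdSpace :=
  { carrier := MCone (SphP m).pt (degTwo m).1,
    pt := mconePt (SphP m).pt (degTwo m).1 (SphP m).pt }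

/-- Binary wedge of bundled pointed spaces. -/
def PtdSpace.wedge (X Y : PtdSpace) : PtdSpace :=
  { carrier := Wedge X.carrier Y.carrier X.pt Y.pt, pt := wedgePt X.carrier Y.carrier X.pt Y.pt }

/-- Generating relation for the wedge of an arbitrary family: identify all basepoints. -/
def BigWedgeRel {ι : Type} (F : ι → PtdSpace) (p q : Σ i, (F i).carrier) : Prop :=
  p.2 = (F p.1).pt ∧ q.2 = (F q.1).pt

/-- The wedge of an arbitrary family of pointed spaces. -/
def BigWedge {ι : Type} (F : ι → PtdSpace) : Type := Quot (BigWedgeRel F)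

instance {ι : Type} (F : ι → PtdSpace) : TopologicalSpace (BigWedge F) :=
  instTopologicalSpaceQuot

/-- The index type of the wedge splitting of `ΣKₙ`: one `S²` summand, and for each
`1 ≤ d ≤ n-1`, `(n-1).choose d` summands. -/
def SplitIndex (n : ℕ) : Type := Unit ⊕ (Σ i : Fin (n - 1), Fin ((n - 1).choose ((i : ℕ) + 1)))

/-- The summands of the wedge splitting of `ΣKₙ`: for each `1 ≤ d ≤ n-1`, `(n-1).choose d`
copies of `S^{d+1} ∨ S^{d+2}` for `d` even, and of `M^{d+2}(2)` for `d` odd. -/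
def SplitSummand (n : ℕ) : SplitIndex n → PtdSpace
  | .inl _ => SphP 1
  | .inr ⟨i, _⟩ =>
      if Even ((i : ℕ) + 1) then (SphP ((i : ℕ) + 1)).wedge (SphP ((i : ℕ) + 2))
      else MooreP ((i : ℕ) + 1)

/-- Basepoint of the wedge splitting. -/
def splitPt (n : ℕ) : BigWedge (SplitSummand n) :=
  Quot.mk _ ⟨Sum.inl (), (SphP 1).pt⟩

/-- Basepoint of the Klein bottle. -/
def kleinBase (n : ℕ) : Klein n := Quot.mk (KleinRel n) fun _ => 1

open Topology

/-! ### Quotient maps and homotopies -/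

theorem isQuotientMap_prod_id {A B : Type} [TopologicalSpace A] [TopologicalSpace B] {f : A → B}
    (hf : IsQuotientMap f) (Y : Type) [TopologicalSpace Y] [LocallyCompactSpace Y] :
    IsQuotientMap (fun p : A × Y => (f p.1, p.2)) := by
  refine (isQuotientMap_iff _).2 ⟨isCoinducing_iff.2 fun s => ⟨fun hs => ?_, fun hs => ?_⟩, fun p => ?_⟩
  · have h : Continuous fun p : B × Y => p ∈ s :=
      hf.continuous_lift_prod_left (isOpen_iff_continuous_mem.1 hs)
    exact isOpen_iff_continuous_mem.2 h
  · exact hs.preimage ((hf.continuous.comp continuous_fst).prodMk continuous_snd)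
  · obtain ⟨a, ha⟩ := hf.surjective p.1
    exact ⟨(a, p.2), Prod.ext ha rfl⟩

theorem ContinuousMap.homotopicRel_of {X Y : Type} [TopologicalSpace X] [TopologicalSpace Y]
    {f g : C(X, Y)} {x₀ : X} (H : X × I → Y) (hc : Continuous H) (h0 : ∀ x, H (x, 0) = f x)
    (h1 : ∀ x, H (x, 1) = g x) (hb : ∀ t, H (x₀, t) = f x₀) : f.HomotopicRel g {x₀} :=
  ⟨{ toFun := fun p => H (p.2, p.1)
     continuous_toFun := hc.comp (continuous_snd.prodMk continuous_fst)
     map_zero_left := h0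
     map_one_left := h1
     prop' := by
      intro t x hx
      rw [Set.mem_singleton_iff.1 hx]
      exact hb t }⟩

theorem ContinuousMap.HomotopicRel.exists_homotopy {X Y : Type} [TopologicalSpace X]
    [TopologicalSpace Y] {f g : C(X, Y)} {x₀ : X} (h : f.HomotopicRel g {x₀}) :
    ∃ H : X × I → Y, Continuous H ∧ (∀ x, H (x, 0) = f x) ∧ (∀ x, H (x, 1) = g x) ∧
      ∀ t, H (x₀, t) = f x₀ := by
  obtain ⟨F⟩ := h
  exact ⟨fun p => F (p.2, p.1), F.continuous.comp (continuous_snd.prodMk continuous_fst),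
    fun x => F.map_zero_left x, fun x => F.map_one_left x, fun t => F.eq_fst t rfl⟩

theorem ContinuousMap.HomotopicRel.precomp {X Y Z : Type} [TopologicalSpace X]
    [TopologicalSpace Y] [TopologicalSpace Z] {f g : C(Y, Z)} {y₀ : Y}
    (h : f.HomotopicRel g {y₀}) (k : C(X, Y)) {x₀ : X} (hk : k x₀ = y₀) :
    (f.comp k).HomotopicRel (g.comp k) {x₀} := by
  obtain ⟨H, hc, h0, h1, hb⟩ := h.exists_homotopy
  refine homotopicRel_of (fun p => H (k p.1, p.2)) (by fun_prop) (fun x => h0 _) (fun x => h1 _) ?_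
  intro t
  simp [hk, hb]

/-! ### Pointed homotopy equivalences -/

namespace PtdHomotopyEquiv

variable {X Y Z : Type} [TopologicalSpace X] [TopologicalSpace Y] [TopologicalSpace Z]
  {x₀ : X} {y₀ : Y} {z₀ : Z}

theorem of_inverse (f : X → Y) (g : Y → X) (hf : Continuous f) (hg : Continuous g)
    (h₀ : f x₀ = y₀) (hgf : ∀ x, g (f x) = x) (hfg : ∀ y, f (g y) = y) :
    PtdHomotopyEquiv X Y x₀ y₀ := by
  refine ⟨⟨f, hf⟩, ⟨g, hg⟩, h₀, by simp [← h₀, hgf], ?_, ?_⟩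
  · rw [show (ContinuousMap.mk g hg).comp ⟨f, hf⟩ = ContinuousMap.id X from
      ContinuousMap.ext hgf]
    exact .refl _
  · rw [show (ContinuousMap.mk f hf).comp ⟨g, hg⟩ = ContinuousMap.id Y from
      ContinuousMap.ext hfg]
    exact .refl _

theorem refl (X : Type) [TopologicalSpace X] (x₀ : X) : PtdHomotopyEquiv X X x₀ x₀ :=
  of_inverse id id continuous_id continuous_id rfl (fun _ => rfl) fun _ => rfl

theorem symm (h : PtdHomotopyEquiv X Y x₀ y₀) : PtdHomotopyEquiv Y X y₀ x₀ := by
  obtain ⟨f, g, hf, hg, h1, h2⟩ := h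
  exact ⟨g, f, hg, hf, h2, h1⟩

theorem trans (h : PtdHomotopyEquiv X Y x₀ y₀) (k : PtdHomotopyEquiv Y Z y₀ z₀) :
    PtdHomotopyEquiv X Z x₀ z₀ := by
  obtain ⟨f, g, hf, hg, h1, h2⟩ := h
  obtain ⟨f', g', hf', hg', h1', h2'⟩ := k
  refine ⟨f'.comp f, g.comp g', by simp [hf, hf'], by simp [hg, hg'], ?_, ?_⟩
  · have := (h1'.comp_continuousMap g).precomp f hf
    exact this.trans h1
  · have := (h2.comp_continuousMap f').precomp g' hg'
    exact this.trans h2'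

end PtdHomotopyEquiv

/-! ### Reduced suspensions -/

section Suspension

variable {X Y Z : Type} [TopologicalSpace X] [TopologicalSpace Y] [TopologicalSpace Z]

theorem isQuotientMap_susp_mk (x₀ : X) :
    IsQuotientMap (Quot.mk (SuspRel x₀) : X × I → Susp X x₀) := isQuotientMap_quot_mk

theorem Susp.mk_zero {x₀ : X} (x : X) :
    (Quot.mk (SuspRel x₀) (x, 0) : Susp X x₀) = suspPt X x₀ :=
  Quot.sound (Or.inl ⟨rfl, rfl⟩)

theorem Susp.mk_base {x₀ : X} (u : I) :
    (Quot.mk (SuspRel x₀) (x₀, u) : Susp X x₀) = suspPt X x₀ :=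
  Quot.sound (Or.inr (Or.inr ⟨rfl, rfl⟩))

theorem Susp.mk_one {x₀ : X} (x : X) :
    (Quot.mk (SuspRel x₀) (x, 1) : Susp X x₀) = suspPt X x₀ :=
  (Quot.sound (r := SuspRel x₀) (Or.inr (Or.inl ⟨rfl, rfl⟩))).trans (Susp.mk_base 1)

/-- Maps out of a reduced suspension. -/
def Susp.lift {x₀ : X} (z₀ : Z) (f : X × I → Z) (h0 : ∀ x, f (x, 0) = z₀)
    (h1 : ∀ x, f (x, 1) = z₀) (hb : ∀ u, f (x₀, u) = z₀) : Susp X x₀ → Z :=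
  Quot.lift f (by
    rintro ⟨x, u⟩ ⟨y, v⟩ (⟨h, h'⟩ | ⟨h, h'⟩ | ⟨h, h'⟩) <;> simp only at h h' <;> subst h <;> subst h'
    · rw [h0, h0]
    · rw [h1, h1]
    · rw [hb, hb])

theorem Susp.continuous_lift {x₀ : X} {z₀ : Z} {f : X × I → Z} {h0 : ∀ x, f (x, 0) = z₀}
    {h1 : ∀ x, f (x, 1) = z₀} {hb : ∀ u, f (x₀, u) = z₀} (hf : Continuous f) :
    Continuous (Susp.lift z₀ f h0 h1 hb) :=
  continuous_quot_lift _ hf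

theorem Susp.homotopicRel {x₀ : X} {z₀ : Z} {f g : C(Susp X x₀, Z)} (H : (X × I) × I → Z)
    (hc : Continuous H) (h0 : ∀ x t, H ((x, 0), t) = z₀) (h1 : ∀ x t, H ((x, 1), t) = z₀)
    (hb : ∀ u t, H ((x₀, u), t) = z₀) (hf : ∀ p, H (p, 0) = f (Quot.mk _ p))
    (hg : ∀ p, H (p, 1) = g (Quot.mk _ p)) : f.HomotopicRel g {suspPt X x₀} := by
  have hz : f (suspPt X x₀) = z₀ := by rw [← h0 x₀ 0, hf]; rfl
  refine ContinuousMap.homotopicRel_of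
    (fun p => Susp.lift z₀ (fun q => H (q, p.2)) (fun x => h0 x _) (fun x => h1 x _)
      (fun u => hb u _) p.1) ?_ ?_ ?_ ?_
  · exact (isQuotientMap_susp_mk x₀).continuous_lift_prod_left hc
  · rintro ⟨p⟩; exact hf p
  · rintro ⟨p⟩; exact hg p
  · intro t; rw [hz]; exact h0 x₀ t

theorem continuous_suspMap {x₀ : X} {y₀ : Y} {f : X → Y} (hf : f x₀ = y₀) (hc : Continuous f) :
    Continuous (suspMap x₀ y₀ f hf) :=
  continuous_quot_lift _ (continuous_quot_mk.comp (by fun_prop))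

theorem suspMap_homotopicRel {x₀ : X} {y₀ : Y} {f g : C(X, Y)} (hf : f x₀ = y₀) (hg : g x₀ = y₀)
    (h : f.HomotopicRel g {x₀}) :
    (ContinuousMap.mk _ (continuous_suspMap hf f.continuous)).HomotopicRel
      ⟨_, continuous_suspMap hg g.continuous⟩ {suspPt X x₀} := by
  obtain ⟨H, hc, h0, h1, hb⟩ := h.exists_homotopy
  refine Susp.homotopicRel (z₀ := suspPt Y y₀)
    (fun p => Quot.mk _ (H (p.1.1, p.2), p.1.2)) ?_ ?_ ?_ ?_ ?_ ?_
  · exact continuous_quot_mk.comp (by fun_prop)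
  · intro x t; exact Susp.mk_zero _
  · intro x t; exact Susp.mk_one _
  · intro u t; simp only [hb, hf]; exact Susp.mk_base _
  · rintro ⟨x, u⟩; simp only [h0]; rfl
  · rintro ⟨x, u⟩; simp only [h1]; rfl

theorem PtdHomotopyEquiv.susp {x₀ : X} {y₀ : Y} (h : PtdHomotopyEquiv X Y x₀ y₀) :
    PtdHomotopyEquiv (Susp X x₀) (Susp Y y₀) (suspPt X x₀) (suspPt Y y₀) := by
  obtain ⟨f, g, hf, hg, h1, h2⟩ := h
  refine ⟨⟨_, continuous_suspMap hf f.continuous⟩, ⟨_, continuous_suspMap hg g.continuous⟩,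
    ?_, ?_, ?_, ?_⟩
  · exact Susp.mk_zero _
  · exact Susp.mk_zero _
  · have := suspMap_homotopicRel (f := g.comp f) (g := ContinuousMap.id X) (y₀ := x₀)
      (by simp [hf, hg]) rfl h1
    convert this using 1 <;> ext ⟨p⟩ <;> rfl
  · have := suspMap_homotopicRel (f := f.comp g) (g := ContinuousMap.id Y) (y₀ := y₀)
      (by simp [hf, hg]) rfl h2
    convert this using 1 <;> ext ⟨p⟩ <;> rfl

/-- The point of the suspension with real height, the height being clamped to `[0, 1]`. -/
def Susp.point (x₀ : X) (x : X) (u : ℝ) : Susp X x₀ :=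
  Quot.mk _ (x, Set.projIcc 0 1 zero_le_one u)

theorem Susp.continuous_point (x₀ : X) :
    Continuous fun p : X × ℝ => Susp.point x₀ p.1 p.2 :=
  continuous_quot_mk.comp (continuous_fst.prodMk (continuous_projIcc.comp continuous_snd))

theorem Susp.point_of_nonpos {x₀ : X} (x : X) {u : ℝ} (hu : u ≤ 0) :
    Susp.point x₀ x u = suspPt X x₀ := by
  rw [Susp.point, Set.projIcc_of_le_left _ hu]; exact Susp.mk_zero x

theorem Susp.point_of_one_le {x₀ : X} (x : X) {u : ℝ} (hu : 1 ≤ u) :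
    Susp.point x₀ x u = suspPt X x₀ := by
  rw [Susp.point, Set.projIcc_of_right_le _ hu]; exact Susp.mk_one x

theorem Susp.point_base {x₀ : X} (u : ℝ) : Susp.point x₀ x₀ u = suspPt X x₀ := Susp.mk_base _

theorem Susp.point_coe {x₀ : X} (x : X) (u : I) :
    Susp.point x₀ x u = Quot.mk _ (x, u) := by
  rw [Susp.point, Set.projIcc_val]

end Suspension

/-! ### Binary wedges -/

section Wedge

variable {X Y Z X' Y' : Type} [TopologicalSpace X] [TopologicalSpace Y] [TopologicalSpace Z]
  [TopologicalSpace X'] [TopologicalSpace Y'] {x₀ : X} {y₀ : Y} {x₀' : X'} {y₀' : Y'}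

/-- The first inclusion into a wedge. -/
def Wedge.inl (x₀ : X) (y₀ : Y) (x : X) : Wedge X Y x₀ y₀ := Quot.mk _ (Sum.inl x)

/-- The second inclusion into a wedge. -/
def Wedge.inr (x₀ : X) (y₀ : Y) (y : Y) : Wedge X Y x₀ y₀ := Quot.mk _ (Sum.inr y)

theorem Wedge.continuous_inl : Continuous (Wedge.inl x₀ y₀) :=
  continuous_quot_mk.comp _root_.continuous_inl

theorem Wedge.continuous_inr : Continuous (Wedge.inr x₀ y₀) :=
  continuous_quot_mk.comp _root_.continuous_inr

theorem Wedge.inl_base : Wedge.inl x₀ y₀ x₀ = wedgePt X Y x₀ y₀ := rfl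

theorem Wedge.inr_base : Wedge.inr x₀ y₀ y₀ = wedgePt X Y x₀ y₀ :=
  (Quot.sound ⟨rfl, rfl⟩ : Quot.mk (WedgeRel x₀ y₀) (Sum.inl x₀) = Quot.mk _ (Sum.inr y₀)).symm

/-- Maps out of a wedge. -/
def Wedge.lift (f : X → Z) (g : Y → Z) (h : f x₀ = g y₀) : Wedge X Y x₀ y₀ → Z :=
  Quot.lift (Sum.elim f g) (by rintro _ _ ⟨rfl, rfl⟩; exact h)

theorem Wedge.continuous_lift {f : X → Z} {g : Y → Z} {h : f x₀ = g y₀} (hf : Continuous f)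
    (hg : Continuous g) : Continuous (Wedge.lift f g h) :=
  continuous_quot_lift _ (hf.sumElim hg)

theorem Wedge.ind {p : Wedge X Y x₀ y₀ → Prop} (hl : ∀ x, p (Wedge.inl x₀ y₀ x))
    (hr : ∀ y, p (Wedge.inr x₀ y₀ y)) (w : Wedge X Y x₀ y₀) : p w := by
  obtain ⟨x | y⟩ := w
  exacts [hl x, hr y]

theorem Wedge.homotopicRel {f g : C(Wedge X Y x₀ y₀, Z)}
    (hl : (f.comp ⟨_, Wedge.continuous_inl⟩).HomotopicRel (g.comp ⟨_, Wedge.continuous_inl⟩) {x₀})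
    (hr : (f.comp ⟨_, Wedge.continuous_inr⟩).HomotopicRel (g.comp ⟨_, Wedge.continuous_inr⟩) {y₀}) :
    f.HomotopicRel g {wedgePt X Y x₀ y₀} := by
  obtain ⟨H, hc, h0, h1, hb⟩ := hl.exists_homotopy
  obtain ⟨K, kc, k0, k1, kb⟩ := hr.exists_homotopy
  refine ContinuousMap.homotopicRel_of
    (fun p => Wedge.lift (fun x => H (x, p.2)) (fun y => K (y, p.2)) ?_ p.1) ?_ ?_ ?_ ?_
  · rw [hb, kb]
    show f (Wedge.inl x₀ y₀ x₀) = f (Wedge.inr x₀ y₀ y₀)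
    rw [Wedge.inl_base, Wedge.inr_base]
  · refine (isQuotientMap_quot_mk (r := WedgeRel x₀ y₀)).continuous_lift_prod_left ?_
    have : Continuous ((Sum.elim H K) ∘ Homeomorph.sumProdDistrib (X := X) (Y := Y) (Z := I)) :=
      (hc.sumElim kc).comp (Homeomorph.continuous _)
    convert this using 1
    ext ⟨x | y, t⟩ <;> rfl
  · refine Wedge.ind (fun x => ?_) fun y => ?_
    exacts [h0 x, k0 y]
  · refine Wedge.ind (fun x => ?_) fun y => ?_
    exacts [h1 x, k1 y]
  · exact hb

theorem PtdHomotopyEquiv.wedge (h : PtdHomotopyEquiv X X' x₀ x₀')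
    (k : PtdHomotopyEquiv Y Y' y₀ y₀') :
    PtdHomotopyEquiv (Wedge X Y x₀ y₀) (Wedge X' Y' x₀' y₀') (wedgePt X Y x₀ y₀)
      (wedgePt X' Y' x₀' y₀') := by
  obtain ⟨f, g, hf, hg, h1, h2⟩ := h
  obtain ⟨f', g', hf', hg', h1', h2'⟩ := k
  refine ⟨⟨Wedge.lift (fun x => Wedge.inl _ _ (f x)) (fun y => Wedge.inr _ _ (f' y)) ?_,
      Wedge.continuous_lift (Wedge.continuous_inl.comp f.continuous)
        (Wedge.continuous_inr.comp f'.continuous)⟩,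
    ⟨Wedge.lift (fun x => Wedge.inl _ _ (g x)) (fun y => Wedge.inr _ _ (g' y)) ?_,
      Wedge.continuous_lift (Wedge.continuous_inl.comp g.continuous)
        (Wedge.continuous_inr.comp g'.continuous)⟩, ?_, ?_, ?_, ?_⟩
  · rw [hf, hf', Wedge.inl_base, Wedge.inr_base]
  · rw [hg, hg', Wedge.inl_base, Wedge.inr_base]
  · show Wedge.inl _ _ (f x₀) = _
    rw [hf]; rfl
  · show Wedge.inl _ _ (g x₀') = _
    rw [hg]; rfl
  · exact Wedge.homotopicRel (h1.comp_continuousMap ⟨_, Wedge.continuous_inl⟩)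
      (h1'.comp_continuousMap ⟨_, Wedge.continuous_inr⟩)
  · exact Wedge.homotopicRel (h2.comp_continuousMap ⟨_, Wedge.continuous_inl⟩)
      (h2'.comp_continuousMap ⟨_, Wedge.continuous_inr⟩)

theorem PtdHomotopyEquiv.susp_wedge :
    PtdHomotopyEquiv (Susp (Wedge X Y x₀ y₀) (wedgePt X Y x₀ y₀))
      (Wedge (Susp X x₀) (Susp Y y₀) (suspPt X x₀) (suspPt Y y₀)) (suspPt _ _) (wedgePt _ _ _ _) := by
  let f : Susp (Wedge X Y x₀ y₀) (wedgePt X Y x₀ y₀) →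
      Wedge (Susp X x₀) (Susp Y y₀) (suspPt X x₀) (suspPt Y y₀) :=
    Susp.lift (wedgePt _ _ _ _)
      (fun p => Wedge.lift (fun x => Wedge.inl _ _ (Quot.mk _ (x, p.2)))
        (fun y => Wedge.inr _ _ (Quot.mk _ (y, p.2)))
        ((congrArg _ (Susp.mk_base p.2)).trans
          (Wedge.inr_base.symm.trans (congrArg _ (Susp.mk_base p.2).symm))) p.1)
      (Wedge.ind (fun x => congrArg (Wedge.inl _ _) (Susp.mk_zero x))
        fun y => (congrArg (Wedge.inr _ _) (Susp.mk_zero y)).trans Wedge.inr_base)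
      (Wedge.ind (fun x => congrArg (Wedge.inl _ _) (Susp.mk_one x))
        fun y => (congrArg (Wedge.inr _ _) (Susp.mk_one y)).trans Wedge.inr_base)
      fun u => congrArg (Wedge.inl _ _) (Susp.mk_base u)
  refine PtdHomotopyEquiv.of_inverse f
    (Wedge.lift (suspMap _ _ (Wedge.inl x₀ y₀) rfl) (suspMap _ _ (Wedge.inr x₀ y₀) Wedge.inr_base)
      ?_) ?_ ?_ ?_ ?_ ?_
  · exact (Susp.mk_zero _).trans (Susp.mk_zero _).symm
  · refine Susp.continuous_lift
      ((isQuotientMap_quot_mk (r := WedgeRel x₀ y₀)).continuous_lift_prod_left ?_)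
    have hl : Continuous fun p : X × I => Wedge.inl (suspPt X x₀) (suspPt Y y₀) (Quot.mk _ p) :=
      Wedge.continuous_inl.comp continuous_quot_mk
    have hr : Continuous fun p : Y × I => Wedge.inr (suspPt X x₀) (suspPt Y y₀) (Quot.mk _ p) :=
      Wedge.continuous_inr.comp continuous_quot_mk
    convert (hl.sumElim hr).comp (Homeomorph.sumProdDistrib (X := X) (Y := Y) (Z := I)).continuous
      using 1
    ext ⟨x | y, t⟩ <;> rfl
  · exact Wedge.continuous_lift (continuous_suspMap _ Wedge.continuous_inl)
      (continuous_suspMap _ Wedge.continuous_inr)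
  · exact congrArg (Wedge.inl _ _) (Susp.mk_zero x₀)
  · rintro ⟨⟨x | y⟩, u⟩ <;> rfl
  · refine Wedge.ind ?_ ?_
    · rintro ⟨x, u⟩; rfl
    · rintro ⟨y, u⟩; rfl

end Wedge

/-! ### Splitting the suspension of a space along a retract -/

/-- The relation collapsing the image of `i` to a point. -/
def CollapseRel {A X : Type} (i : A → X) (x y : X) : Prop := x ∈ Set.range i ∧ y ∈ Set.range i

/-- `A` is a retract of `X = Quot s`, and a neighbourhood of `A` (the locus `h < 1`, where `h` is
a function upstairs) is deformed into `A` along the retraction. -/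
structure CollaredRetract {E A : Type} [TopologicalSpace E] [TopologicalSpace A]
    (s : E → E → Prop) (a₀ : A) where
  i : A → Quot s
  r : Quot s → A
  ρ : Quot s × ℝ → Quot s
  h : E → ℝ
  continuous_i : Continuous i
  continuous_r : Continuous r
  continuous_ρ : Continuous ρ
  continuous_h : Continuous h
  r_i : ∀ a, r (i a) = a
  ρ_zero : ∀ x, ρ (x, 0) = x
  ρ_i : ∀ a t, ρ (i a, t) = i a
  r_ρ : ∀ x t, r (ρ (x, t)) = r x
  h_rel : ∀ x y, s x y → h x = h y ∨ (Quot.mk s x = i a₀ ∧ Quot.mk s y = i a₀)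
  h_i : ∀ x a, Quot.mk s x = i a → h x ≤ 0 ∨ Quot.mk s x = i a₀
  ρ_one : ∀ x, h x < 1 → ρ (Quot.mk s x, 1) = i (r (Quot.mk s x))

namespace CollaredRetract

variable {E A : Type} [TopologicalSpace E] [TopologicalSpace A] {s : E → E → Prop} {a₀ : A}
  (D : CollaredRetract s a₀)

/-- The quotient by the retract. -/
abbrev Quotient : Type := Quot (CollapseRel D.i)

/-- The quotient map by the retract. -/
def q (x : Quot s) : D.Quotient := Quot.mk _ x

theorem continuous_q : Continuous D.q := continuous_quot_mk

theorem q_i (a : A) : D.q (D.i a) = D.q (D.i a₀) := Quot.sound ⟨⟨a, rfl⟩, ⟨a₀, rfl⟩⟩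

/-- The wedge of the suspensions of the retract and of the quotient. -/
abbrev Target : Type :=
  Wedge (Susp A a₀) (Susp D.Quotient (D.q (D.i a₀))) (suspPt _ _) (suspPt _ _)

/-- The base point of the target. -/
abbrev targetPt : D.Target := wedgePt _ _ _ _

/-- The point of the first summand over `a` at height `u`. -/
def left (a : A) (u : ℝ) : D.Target := Wedge.inl _ _ (Susp.point a₀ a u)

/-- The point of the second summand over `y` at height `u`. -/
def right (y : D.Quotient) (u : ℝ) : D.Target := Wedge.inr _ _ (Susp.point (D.q (D.i a₀)) y u)

theorem continuous_left : Continuous fun p : A × ℝ => D.left p.1 p.2 :=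
  Wedge.continuous_inl.comp (Susp.continuous_point _)

theorem continuous_right : Continuous fun p : D.Quotient × ℝ => D.right p.1 p.2 :=
  Wedge.continuous_inr.comp (Susp.continuous_point _)

theorem left_nonpos (a : A) {u : ℝ} (hu : u ≤ 0) : D.left a u = D.targetPt :=
  congrArg _ (Susp.point_of_nonpos a hu)

theorem left_one_le (a : A) {u : ℝ} (hu : 1 ≤ u) : D.left a u = D.targetPt :=
  congrArg (Wedge.inl _ _) (Susp.point_of_one_le a hu)

theorem left_base (u : ℝ) : D.left a₀ u = D.targetPt :=
  congrArg (Wedge.inl _ _) (Susp.point_base u)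

theorem right_nonpos (y : D.Quotient) {u : ℝ} (hu : u ≤ 0) : D.right y u = D.targetPt :=
  (congrArg (Wedge.inr _ _) (Susp.point_of_nonpos y hu)).trans Wedge.inr_base

theorem right_one_le (y : D.Quotient) {u : ℝ} (hu : 1 ≤ u) : D.right y u = D.targetPt :=
  (congrArg (Wedge.inr _ _) (Susp.point_of_one_le y hu)).trans Wedge.inr_base

theorem right_i (a : A) (u : ℝ) : D.right (D.q (D.i a)) u = D.targetPt := by
  rw [q_i]
  exact (congrArg (Wedge.inr _ _) (Susp.point_base u)).trans Wedge.inr_base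

/-- The pinch map `ΣX → ΣA ∨ Σ(X/A)` on representatives. -/
def pinch (x : Quot s) (u : ℝ) : D.Target :=
  if u ≤ 1 / 2 then D.left (D.r x) (2 * u) else D.right (D.q x) (2 * u - 1)

theorem continuous_pinch : Continuous fun p : Quot s × ℝ => D.pinch p.1 p.2 := by
  have hr := D.continuous_r
  have hq := D.continuous_q
  refine Continuous.if_le ?_ ?_ continuous_snd continuous_const ?_
  · exact D.continuous_left.comp (f := fun p : Quot s × ℝ => (D.r p.1, 2 * p.2)) (by fun_prop)
  · exact D.continuous_right.comp (f := fun p : Quot s × ℝ => (D.q p.1, 2 * p.2 - 1)) (by fun_prop)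
  · rintro ⟨x, u⟩ hu
    simp only at hu
    simp only
    rw [left_one_le _ _ (by linarith), right_nonpos _ _ (by linarith)]

theorem pinch_i (a : A) (u : ℝ) : D.pinch (D.i a) u = D.left a (2 * u) := by
  unfold pinch
  split_ifs with h
  · rw [r_i]
  · rw [right_i, left_one_le _ _ (by linarith)]

theorem pinch_nonpos (x : Quot s) {u : ℝ} (hu : u ≤ 0) : D.pinch x u = D.targetPt := by
  rw [pinch, if_pos (by linarith), left_nonpos _ _ (by linarith)]

theorem pinch_one_le (x : Quot s) {u : ℝ} (hu : 1 ≤ u) : D.pinch x u = D.targetPt := by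
  rw [pinch, if_neg (by linarith), right_one_le _ _ (by linarith)]

theorem pinch_of_half_le (x : Quot s) {u : ℝ} (hu : 1 / 2 ≤ u) :
    D.pinch x u = D.right (D.q x) (2 * u - 1) := by
  rcases hu.eq_or_lt with rfl | hu
  · rw [pinch, if_pos le_rfl, left_one_le _ _ (by norm_num), right_nonpos _ _ (by norm_num)]
  · rw [pinch, if_neg (by linarith)]

theorem pinch_projIcc (x : Quot s) (u : ℝ) :
    D.pinch x (Set.projIcc (0 : ℝ) 1 zero_le_one u : I) = D.pinch x u := by
  rcases le_total u 0 with h | h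
  · rw [Set.projIcc_of_le_left _ h, pinch_nonpos _ _ le_rfl, pinch_nonpos _ _ h]
  rcases le_total 1 u with h' | h'
  · rw [Set.projIcc_of_right_le _ h', pinch_one_le _ _ le_rfl, pinch_one_le _ _ h']
  · rw [Set.projIcc_of_mem _ ⟨h, h'⟩]

/-- The map `ΣX → ΣA ∨ Σ(X/A)`, the sum of the retraction and the quotient map. -/
def toTarget : Susp (Quot s) (D.i a₀) → D.Target :=
  Susp.lift D.targetPt (fun p => D.pinch p.1 p.2) (fun x => D.pinch_nonpos x le_rfl)
    (fun x => D.pinch_one_le x le_rfl) fun u => by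
      show D.pinch (D.i a₀) u = _
      rw [pinch_i, left_base]

theorem continuous_toTarget : Continuous D.toTarget :=
  Susp.continuous_lift (D.continuous_pinch.comp
    (f := fun p : Quot s × I => (p.1, (p.2 : ℝ))) (by fun_prop))

theorem toTarget_point (x : Quot s) (u : ℝ) :
    D.toTarget (Susp.point _ x u) = D.pinch x u := D.pinch_projIcc x u

/-- The point of `ΣX` over `x` at height `u`. -/
abbrev pt (x : Quot s) (u : ℝ) : Susp (Quot s) (D.i a₀) := Susp.point _ x u

/-- The truncation level of the section. -/
def level (x : E) (β : ℝ) : ℝ := min (1 - D.h x) β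

theorem continuous_level : Continuous fun p : E × ℝ => D.level p.1 p.2 := by
  have := D.continuous_h
  unfold level
  fun_prop

/-- The section `Σ(X/A) → ΣX`, `x ↦ - r x + x`, on representatives upstairs. -/
def diff (x : E) (u : ℝ) : Susp (Quot s) (D.i a₀) :=
  if u ≤ 1 / 2 then D.pt (D.i (D.r (Quot.mk s x))) (max (1 - 2 * u) (D.level x 1))
  else D.pt (D.ρ (Quot.mk s x, 1)) (max (2 * u - 1) (D.level x 1))

theorem pt_i_eq {x : E} (h : D.h x < 1) (u : ℝ) :
    D.pt (D.ρ (Quot.mk s x, 1)) u = D.pt (D.i (D.r (Quot.mk s x))) u := by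
  rw [D.ρ_one x h]

theorem continuous_diff : Continuous fun p : E × ℝ => D.diff p.1 p.2 := by
  have hr := D.continuous_r
  have hi := D.continuous_i
  have hρ := D.continuous_ρ
  have hm : Continuous (Quot.mk s) := continuous_quot_mk
  have hl : Continuous fun p : E × ℝ => D.level p.1 1 :=
    D.continuous_level.comp (f := fun p : E × ℝ => (p.1, (1 : ℝ))) (by fun_prop)
  refine Continuous.if_le ?_ ?_ continuous_snd continuous_const ?_
  · exact (Susp.continuous_point (D.i a₀)).comp (f := fun p : E × ℝ =>
      (D.i (D.r (Quot.mk s p.1)), max (1 - 2 * p.2) (D.level p.1 1))) (by fun_prop)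
  · exact (Susp.continuous_point (D.i a₀)).comp (f := fun p : E × ℝ =>
      (D.ρ (Quot.mk s p.1, 1), max (2 * p.2 - 1) (D.level p.1 1))) (by fun_prop)
  · rintro ⟨x, u⟩ hu
    simp only at hu
    subst hu
    simp only
    by_cases h : D.h x < 1
    · rw [pt_i_eq _ h]; norm_num
    · have : D.level x 1 ≤ 0 := (min_le_left _ _).trans (by linarith)
      exact (Susp.point_of_nonpos _ (by simp [this])).trans
        (Susp.point_of_nonpos _ (by simp [this])).symm

theorem diff_of_mk_eq_base {x : E} (hx : Quot.mk s x = D.i a₀) (u : ℝ) :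
    D.diff x u = suspPt _ _ := by
  unfold diff
  rw [hx, D.r_i, D.ρ_i]
  simp [Susp.point_base]

theorem diff_of_mem {x : E} {a : A} (hx : Quot.mk s x = D.i a) (u : ℝ) :
    D.diff x u = suspPt _ _ := by
  rcases D.h_i x a hx with h | h
  · have : 1 ≤ D.level x 1 := le_min (by linarith) le_rfl
    unfold diff
    split_ifs <;> exact Susp.point_of_one_le _ (le_max_of_le_right this)
  · exact D.diff_of_mk_eq_base h u

theorem diff_rel {x y : E} (h : s x y) (u : ℝ) : D.diff x u = D.diff y u := by
  rcases D.h_rel x y h with h' | ⟨h1, h2⟩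
  · unfold diff level
    rw [Quot.sound h, h']
  · rw [D.diff_of_mk_eq_base h1, D.diff_of_mk_eq_base h2]

/-- Descend a function on `E × T` to `X/A × T`. -/
def descend {T Z : Type} (K : E × T → Z) (h1 : ∀ x y t, s x y → K (x, t) = K (y, t))
    (z₀ : T → Z) (h2 : ∀ x a t, Quot.mk s x = D.i a → K (x, t) = z₀ t) (p : D.Quotient × T) : Z :=
  Quot.lift (fun x : Quot s => Quot.lift (fun e => K (e, p.2)) (fun x y h => h1 x y p.2 h) x)
    (by
      rintro ⟨x⟩ ⟨y⟩ ⟨⟨a, ha⟩, ⟨b, hb⟩⟩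
      exact (h2 x a _ ha.symm).trans (h2 y b _ hb.symm).symm) p.1

theorem continuous_descend {T Z : Type} [TopologicalSpace T] [LocallyCompactSpace T]
    [TopologicalSpace Z] {K : E × T → Z} {h1 : ∀ x y t, s x y → K (x, t) = K (y, t)}
    {z₀ : T → Z} {h2 : ∀ x a t, Quot.mk s x = D.i a → K (x, t) = z₀ t} (hK : Continuous K) :
    Continuous (D.descend K h1 z₀ h2) :=
  ((isQuotientMap_quot_mk (r := CollapseRel D.i)).comp
    (isQuotientMap_quot_mk (r := s))).continuous_lift_prod_left hK

/-- The map `Σ(X/A) → ΣX`. -/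
def ofQuotient : Susp D.Quotient (D.q (D.i a₀)) → Susp (Quot s) (D.i a₀) :=
  Susp.lift (suspPt _ _)
    (D.descend (fun p : E × I => D.diff p.1 p.2) (fun _ _ t h => D.diff_rel h t)
      (fun _ => suspPt _ _) fun _ _ t h => D.diff_of_mem h t)
    (by
      rintro ⟨⟨x⟩⟩
      show D.diff x ((0 : I) : ℝ) = _
      rw [diff, if_pos (by simp)]
      exact Susp.point_of_one_le _ (by simp))
    (by
      rintro ⟨⟨x⟩⟩
      show D.diff x ((1 : I) : ℝ) = _
      rw [diff, if_neg (by norm_num)]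
      exact Susp.point_of_one_le _ (by norm_num))
    (by
      intro u
      have key : ∀ y, y = D.i a₀ → D.descend (fun p : E × I => D.diff p.1 p.2)
          (fun _ _ t h => D.diff_rel h t) (fun _ => suspPt _ _) (fun _ _ t h => D.diff_of_mem h t)
          (D.q y, u) = suspPt _ _ := by
        rintro ⟨x⟩ hx
        exact D.diff_of_mem hx u
      exact key _ rfl)

theorem continuous_ofQuotient : Continuous D.ofQuotient :=
  Susp.continuous_lift (D.continuous_descend (D.continuous_diff.comp
    (f := fun p : E × I => (p.1, (p.2 : ℝ))) (by fun_prop)))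

/-- The map `ΣA ∨ Σ(X/A) → ΣX`. -/
def ofTarget : D.Target → Susp (Quot s) (D.i a₀) :=
  Wedge.lift (suspMap a₀ (D.i a₀) D.i rfl) D.ofQuotient (by
    have key : ∀ y, y = D.i a₀ → D.ofQuotient (Quot.mk _ (D.q y, 0)) = suspPt _ _ := by
      rintro ⟨x⟩ hx
      exact D.diff_of_mem hx _
    exact (Susp.mk_zero (x₀ := D.i a₀) (D.i a₀)).trans (key _ rfl).symm)

theorem continuous_ofTarget : Continuous D.ofTarget :=
  Wedge.continuous_lift (continuous_suspMap _ D.continuous_i) D.continuous_ofQuotient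

theorem ofTarget_left (a : A) (u : ℝ) : D.ofTarget (D.left a u) = D.pt (D.i a) u := rfl

theorem ofTarget_right (x : E) (u : ℝ) :
    D.ofTarget (D.right (D.q (Quot.mk s x)) u) =
      D.diff x (Set.projIcc (0 : ℝ) 1 zero_le_one u : I) := rfl


theorem homotopicRel_of_quotient {Z : Type} [TopologicalSpace Z] {z₀ : Z}
    {f g : C(Susp D.Quotient (D.q (D.i a₀)), Z)} (K : E × (I × I) → Z) (hc : Continuous K)
    (hs : ∀ x y p, s x y → K (x, p) = K (y, p)) (hA : ∀ x a p, Quot.mk s x = D.i a → K (x, p) = z₀)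
    (h0 : ∀ x t, K (x, (0, t)) = z₀) (h1 : ∀ x t, K (x, (1, t)) = z₀)
    (hf : ∀ x u, K (x, (u, 0)) = f (Quot.mk _ (D.q (Quot.mk s x), u)))
    (hg : ∀ x u, K (x, (u, 1)) = g (Quot.mk _ (D.q (Quot.mk s x), u))) :
    f.HomotopicRel g {suspPt _ _} := by
  refine Susp.homotopicRel (z₀ := z₀)
    (fun p => D.descend K hs (fun _ => z₀) hA (p.1.1, (p.1.2, p.2))) ?_ ?_ ?_ ?_ ?_ ?_
  · exact (D.continuous_descend hc).comp
      (f := fun p : (D.Quotient × I) × I => (p.1.1, (p.1.2, p.2))) (by fun_prop)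
  · rintro ⟨⟨x⟩⟩ t; exact h0 x t
  · rintro ⟨⟨x⟩⟩ t; exact h1 x t
  · intro u t
    have key : ∀ y, y = D.i a₀ → D.descend K hs (fun _ => z₀) hA (D.q y, (u, t)) = z₀ := by
      rintro ⟨x⟩ hx
      exact hA x a₀ _ hx
    exact key _ rfl
  · rintro ⟨⟨⟨x⟩⟩, u⟩; exact hf x u
  · rintro ⟨⟨⟨x⟩⟩, u⟩; exact hg x u

/-- The homotopy from `toTarget ∘ ofTarget` on the second summand, sliding the path
`- r x + x` off the retract. -/
def slide (x : E) (u β : ℝ) : D.Target :=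
  if u ≤ 1 / 2 then D.left (D.r (Quot.mk s x)) (2 * max (max (1 - 2 * u) (D.level x 1)) β)
  else D.pinch (D.ρ (Quot.mk s x, 1)) (max (max (2 * u - 1) (D.level x 1)) β)

theorem continuous_slide :
    Continuous fun p : E × (ℝ × I) => D.slide p.1 p.2.1 (p.2.2 / 2) := by
  have hr := D.continuous_r
  have hρ := D.continuous_ρ
  have hm : Continuous (Quot.mk s) := continuous_quot_mk
  have hl : Continuous fun p : E × (ℝ × I) => D.level p.1 1 :=
    D.continuous_level.comp (f := fun p : E × (ℝ × I) => (p.1, (1 : ℝ))) (by fun_prop)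
  refine Continuous.if_le ?_ ?_ (by fun_prop) continuous_const ?_
  · exact D.continuous_left.comp (f := fun p : E × (ℝ × I) =>
      (D.r (Quot.mk s p.1), 2 * max (max (1 - 2 * p.2.1) (D.level p.1 1)) (p.2.2 / 2)))
      (by fun_prop)
  · exact D.continuous_pinch.comp (f := fun p : E × (ℝ × I) =>
      (D.ρ (Quot.mk s p.1, 1), max (max (2 * p.2.1 - 1) (D.level p.1 1)) (p.2.2 / 2)))
      (by fun_prop)
  · rintro ⟨x, u, t⟩ hu
    simp only at hu
    subst hu
    simp only
    by_cases h : D.h x < 1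
    · rw [D.ρ_one x h, pinch_i]; norm_num
    · have hlev : D.level x 1 ≤ 0 := (min_le_left _ _).trans (by linarith)
      have h0 := t.2.1
      have h1 := t.2.2
      have e1 : max (max (1 - 2 * (1 / 2)) (D.level x 1)) ((t : ℝ) / 2) = t / 2 := by
        apply max_eq_right; apply max_le <;> linarith
      have e2 : max (max (2 * (1 / 2) - 1) (D.level x 1)) ((t : ℝ) / 2) = t / 2 := by
        apply max_eq_right; apply max_le <;> linarith
      rw [e1, e2, pinch, if_pos (by linarith), D.r_ρ]

theorem slide_of_base {x : E} (hx : Quot.mk s x = D.i a₀) (u β : ℝ) :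
    D.slide x u β = D.targetPt := by
  unfold slide
  rw [hx, D.r_i, D.ρ_i, pinch_i, left_base, left_base, ite_self]

theorem slide_of_mem {x : E} {a : A} (hx : Quot.mk s x = D.i a) (u β : ℝ) :
    D.slide x u β = D.targetPt := by
  rcases D.h_i x a hx with h | h
  · have : 1 ≤ D.level x 1 := le_min (by linarith) le_rfl
    unfold slide
    split_ifs
    · apply left_one_le
      have := le_max_of_le_left (c := β) (le_max_of_le_right (b := 1 - 2 * u) this)
      linarith
    · exact pinch_one_le _ _ (le_max_of_le_left (le_max_of_le_right this))
  · exact D.slide_of_base h u β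

theorem slide_rel {x y : E} (h : s x y) (u β : ℝ) : D.slide x u β = D.slide y u β := by
  rcases D.h_rel x y h with h' | ⟨h1, h2⟩
  · unfold slide level
    rw [Quot.sound h, h']
  · rw [D.slide_of_base h1, D.slide_of_base h2]

theorem slide_nonpos (x : E) {u : ℝ} (hu : u ≤ 0) (β : ℝ) : D.slide x u β = D.targetPt := by
  rw [slide, if_pos (by linarith)]
  apply left_one_le
  have : 1 ≤ max (max (1 - 2 * u) (D.level x 1)) β :=
    le_max_of_le_left (le_max_of_le_left (by linarith))
  linarith

theorem slide_one_le (x : E) {u : ℝ} (hu : 1 ≤ u) (β : ℝ) : D.slide x u β = D.targetPt := by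
  rw [slide, if_neg (by linarith)]
  exact pinch_one_le _ _ (le_max_of_le_left (le_max_of_le_left (by linarith)))

theorem toTarget_diff (x : E) {u : ℝ} : D.toTarget (D.diff x u) = D.slide x u 0 := by
  unfold diff slide
  split_ifs with h
  · rw [toTarget_point, pinch_i]
    congr 2
    exact (max_eq_left (le_max_of_le_left (by linarith))).symm
  · rw [toTarget_point]
    congr 1
    exact (max_eq_left (le_max_of_le_left (by linarith))).symm

theorem slide_half (x : E) (u : ℝ) :
    D.slide x u (1 / 2) = D.right (D.q (D.ρ (Quot.mk s x, 1))) (4 * u - 3) := by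
  unfold slide
  split_ifs with h
  · rw [right_nonpos _ _ (by linarith)]
    apply left_one_le
    have := le_max_right (max (1 - 2 * u) (D.level x 1)) (1 / 2)
    linarith
  · rw [pinch_of_half_le _ _ (le_max_right _ _)]
    by_cases h' : D.h x < 1
    · rw [D.ρ_one x h', right_i, right_i]
    · have hlev : D.level x 1 ≤ 0 := (min_le_left _ _).trans (by linarith)
      rw [max_eq_left (a := 2 * u - 1) (by linarith)]
      rcases le_total (2 * u - 1) (1 / 2) with h2 | h2
      · rw [right_nonpos _ _ (by rw [max_eq_right h2]; norm_num),
          right_nonpos _ _ (by linarith)]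
      · rw [max_eq_left h2]; congr 1; ring

/-- The map which `toTarget ∘ ofTarget` restricts to on the second summand, up to homotopy. -/
def mid : C(Susp D.Quotient (D.q (D.i a₀)), D.Target) where
  toFun := Susp.lift D.targetPt
    (D.descend (fun p : E × I => D.right (D.q (D.ρ (Quot.mk s p.1, 1))) (4 * p.2 - 3))
      (fun _ _ t h => by simp only [Quot.sound h]) (fun _ => D.targetPt)
      fun x a t h => by simp only [h, D.ρ_i, right_i])
    (by
      rintro ⟨⟨x⟩⟩
      exact D.right_nonpos _ (by simp))
    (by
      rintro ⟨⟨x⟩⟩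
      exact D.right_one_le _ (by norm_num))
    (by
      intro u
      have key : ∀ y, y = D.i a₀ → D.descend
          (fun p : E × I => D.right (D.q (D.ρ (Quot.mk s p.1, 1))) (4 * p.2 - 3))
          (fun _ _ t h => by simp only [Quot.sound h]) (fun _ => D.targetPt)
          (fun x a t h => by simp only [h, D.ρ_i, right_i]) (D.q y, u) = D.targetPt := by
        rintro ⟨x⟩ hx
        show D.right (D.q (D.ρ (Quot.mk s x, 1))) _ = _
        rw [hx, D.ρ_i, right_i]
      exact key _ rfl)
  continuous_toFun := by
    have hρ := D.continuous_ρ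
    have hq := D.continuous_q
    have hm : Continuous (Quot.mk s) := continuous_quot_mk
    exact Susp.continuous_lift (D.continuous_descend (D.continuous_right.comp
      (f := fun p : E × I => (D.q (D.ρ (Quot.mk s p.1, 1)), 4 * (p.2 : ℝ) - 3)) (by fun_prop)))

theorem toTarget_ofTarget_homotopicRel :
    ((ContinuousMap.mk _ D.continuous_toTarget).comp ⟨_, D.continuous_ofTarget⟩).HomotopicRel
      (ContinuousMap.id _) {D.targetPt} := by
  have hρ := D.continuous_ρ
  have hq := D.continuous_q
  have hm : Continuous (Quot.mk s) := continuous_quot_mk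
  refine Wedge.homotopicRel ?_ ?_
  · refine Susp.homotopicRel (z₀ := D.targetPt)
      (fun p => D.left p.1.1 ((2 - p.2) * p.1.2)) ?_ ?_ ?_ ?_ ?_ ?_
    · exact D.continuous_left.comp
        (f := fun p : (A × I) × I => (p.1.1, (2 - (p.2 : ℝ)) * p.1.2)) (by fun_prop)
    · intro a t; exact D.left_nonpos _ (by simp)
    · intro a t
      apply left_one_le
      have := t.2.2
      simp only [Set.Icc.coe_one]; linarith
    · intro u t; exact D.left_base _
    · rintro ⟨a, u⟩
      have := D.pinch_i a u
      simp only [Set.Icc.coe_zero, sub_zero]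
      rw [← this]; rfl
    · rintro ⟨a, u⟩
      simp only [Set.Icc.coe_one]
      norm_num
      exact congrArg (Wedge.inl _ _) (Susp.point_coe a u)
  · refine ContinuousMap.HomotopicRel.trans (g := D.mid) ?_ ?_
    · refine D.homotopicRel_of_quotient (z₀ := D.targetPt)
        (fun p => D.slide p.1 p.2.1 (p.2.2 / 2)) ?_ ?_ ?_ ?_ ?_ ?_ ?_
      · exact D.continuous_slide.comp
          (f := fun p : E × (I × I) => (p.1, ((p.2.1 : ℝ), p.2.2))) (by fun_prop)
      · intro x y p h; exact D.slide_rel h _ _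
      · intro x a p h; exact D.slide_of_mem h _ _
      · intro x t; exact D.slide_nonpos _ (by simp) _
      · intro x t; exact D.slide_one_le _ (by simp) _
      · intro x u
        simp only [Set.Icc.coe_zero, zero_div]
        exact (D.toTarget_diff x).symm
      · intro x u
        simp only [Set.Icc.coe_one]
        exact D.slide_half x u
    · refine D.homotopicRel_of_quotient (z₀ := D.targetPt)
        (fun p => D.right (D.q (D.ρ (Quot.mk s p.1, 1 - p.2.2)))
          ((4 * p.2.1 - 3) * (1 - p.2.2) + p.2.2 * p.2.1)) ?_ ?_ ?_ ?_ ?_ ?_ ?_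
      · exact D.continuous_right.comp (f := fun p : E × (I × I) =>
          (D.q (D.ρ (Quot.mk s p.1, 1 - (p.2.2 : ℝ))),
            (4 * (p.2.1 : ℝ) - 3) * (1 - p.2.2) + p.2.2 * p.2.1)) (by fun_prop)
      · intro x y p h; simp only [Quot.sound h]
      · intro x a p h; simp only [h, D.ρ_i, right_i]
      · intro x t
        apply right_nonpos
        have := t.2.2
        simp only [Set.Icc.coe_zero]; linarith
      · intro x t
        apply right_one_le
        simp only [Set.Icc.coe_one]; linarith
      · intro x u
        simp only [Set.Icc.coe_zero, sub_zero, mul_one, zero_mul, add_zero]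
        rfl
      · intro x u
        simp only [Set.Icc.coe_one, sub_self, mul_zero, zero_add, one_mul, D.ρ_zero]
        exact congrArg (Wedge.inr _ _) (Susp.point_coe _ u)

/-- The homotopy from `ofTarget ∘ toTarget` cancelling the paths `r x` and `- r x`. -/
def cancel (x : E) (u a τ β : ℝ) : Susp (Quot s) (D.i a₀) :=
  if u ≤ 1 / 2 then D.pt (D.i (D.r (Quot.mk s x))) (2 * u * a)
  else if u ≤ 3 / 4 then D.pt (D.i (D.r (Quot.mk s x))) (max (a * (3 - 4 * u)) (D.level x β))
  else D.pt (D.ρ (Quot.mk s x, τ)) (max (4 * u - 3) (D.level x β))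

theorem continuous_cancel {T : Type} [TopologicalSpace T] {u a τ β : T → ℝ} (hu : Continuous u)
    (ha : Continuous a) (hτ : Continuous τ) (hβ : Continuous β) (ha0 : ∀ t, 0 ≤ a t)
    (h : ∀ t, (a t = 1 ∧ τ t = 1) ∨ β t = 0) :
    Continuous fun p : E × T => D.cancel p.1 (u p.2) (a p.2) (τ p.2) (β p.2) := by
  have hr := D.continuous_r
  have hi := D.continuous_i
  have hρ := D.continuous_ρ
  have hm : Continuous (Quot.mk s) := continuous_quot_mk
  have hl : Continuous fun p : E × T => D.level p.1 (β p.2) :=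
    D.continuous_level.comp (f := fun p : E × T => (p.1, β p.2)) (by fun_prop)
  refine Continuous.if_le ?_ (Continuous.if_le ?_ ?_ (by fun_prop) continuous_const ?_)
    (by fun_prop) continuous_const ?_
  · exact (Susp.continuous_point (D.i a₀)).comp (f := fun p : E × T =>
      (D.i (D.r (Quot.mk s p.1)), 2 * u p.2 * a p.2)) (by fun_prop)
  · exact (Susp.continuous_point (D.i a₀)).comp (f := fun p : E × T =>
      (D.i (D.r (Quot.mk s p.1)), max (a p.2 * (3 - 4 * u p.2)) (D.level p.1 (β p.2))))
      (by fun_prop)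
  · exact (Susp.continuous_point (D.i a₀)).comp (f := fun p : E × T =>
      (D.ρ (Quot.mk s p.1, τ p.2), max (4 * u p.2 - 3) (D.level p.1 (β p.2)))) (by fun_prop)
  · rintro ⟨x, t⟩ hu
    simp only at hu ⊢
    rw [hu]
    by_cases hx : D.h x < 1 ∧ τ t = 1
    · rw [hx.2, pt_i_eq _ hx.1]; norm_num
    · have : D.level x (β t) ≤ 0 := by
        rcases h t with ⟨-, h⟩ | h
        · exact (min_le_left _ _).trans (by
            have : ¬ D.h x < 1 := fun h' => hx ⟨h', h⟩
            linarith)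
        · exact (min_le_right _ _).trans h.le
      exact (Susp.point_of_nonpos _ (max_le (by norm_num) this)).trans
        (Susp.point_of_nonpos _ (max_le (by norm_num) this)).symm
  · rintro ⟨x, t⟩ hu
    simp only at hu ⊢
    rw [hu, if_pos (by norm_num)]
    rcases h t with ⟨h, -⟩ | h
    · rw [h]
      exact (Susp.point_of_one_le _ (by norm_num)).trans
        (Susp.point_of_one_le _ (le_max_of_le_left (by norm_num))).symm
    · congr 1
      rw [h, max_eq_left]
      · ring
      · exact (min_le_right _ _).trans (by linarith [ha0 t])

theorem cancel_of_base {x : E} (hx : Quot.mk s x = D.i a₀) (u a τ β : ℝ) :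
    D.cancel x u a τ β = suspPt _ _ := by
  unfold cancel
  rw [hx, D.r_i, D.ρ_i]
  simp [Susp.point_base]

theorem cancel_rel {x y : E} (h : s x y) (u a τ β : ℝ) :
    D.cancel x u a τ β = D.cancel y u a τ β := by
  rcases D.h_rel x y h with h' | ⟨h1, h2⟩
  · unfold cancel level
    rw [Quot.sound h, h']
  · rw [D.cancel_of_base h1, D.cancel_of_base h2]

theorem ofTarget_pinch (x : E) (u : I) :
    D.ofTarget (D.pinch (Quot.mk s x) u) = D.cancel x u 1 1 1 := by
  unfold pinch cancel
  have h1 := u.2.2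
  split_ifs with h h'
  · rw [ofTarget_left, mul_one]
  · rw [ofTarget_right, Set.projIcc_of_mem _ ⟨by linarith, by linarith⟩, diff, if_pos]
    · congr 2; simp only; ring
    · simp only; linarith
  · rw [ofTarget_right, Set.projIcc_of_mem _ ⟨by linarith, by linarith⟩, diff, if_neg]
    · congr 2; simp only; ring
    · simp only; linarith

theorem cancel_zero (x : E) (u : ℝ) :
    D.cancel x u 0 0 0 = D.pt (Quot.mk s x) (4 * u - 3) := by
  have hl : D.level x 0 ≤ 0 := min_le_right _ _
  unfold cancel
  split_ifs with h h'
  · exact (Susp.point_of_nonpos _ (by simp)).trans (Susp.point_of_nonpos _ (by linarith)).symm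
  · exact (Susp.point_of_nonpos _ (by simp [hl])).trans (Susp.point_of_nonpos _ (by linarith)).symm
  · rw [D.ρ_zero, max_eq_left (by linarith)]

theorem ofTarget_toTarget_homotopicRel :
    ((ContinuousMap.mk _ D.continuous_ofTarget).comp ⟨_, D.continuous_toTarget⟩).HomotopicRel
      (ContinuousMap.id _) {suspPt _ _} := by
  let m : C(Susp (Quot s) (D.i a₀), Susp (Quot s) (D.i a₀)) :=
    ⟨Susp.lift (suspPt _ _) (fun p => D.pt p.1 (4 * p.2 - 3))
      (fun x => Susp.point_of_nonpos _ (by simp)) (fun x => Susp.point_of_one_le _ (by norm_num))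
      fun u => Susp.point_base _,
    Susp.continuous_lift ((Susp.continuous_point _).comp
      (f := fun p : Quot s × I => (p.1, 4 * (p.2 : ℝ) - 3)) (by fun_prop))⟩
  refine ContinuousMap.HomotopicRel.trans (g := m) ?_ ?_
  · have hK : Continuous fun p : E × (I × I) => D.cancel p.1 p.2.1 (min 1 (2 - 2 * p.2.2))
        (min 1 (2 - 2 * p.2.2)) (max 0 (1 - 2 * p.2.2)) := by
      refine D.continuous_cancel (T := I × I) (u := fun t => t.1)
        (a := fun t => min 1 (2 - 2 * t.2)) (τ := fun t => min 1 (2 - 2 * t.2))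
        (β := fun t => max 0 (1 - 2 * t.2)) (by fun_prop) (by fun_prop) (by fun_prop)
        (by fun_prop) ?_ ?_
      · intro t
        have := t.2.2.2
        exact le_min (by norm_num) (by linarith)
      · intro t
        rcases le_total (1 / 2) (t.2 : ℝ) with h | h
        · right; exact max_eq_left (by linarith)
        · left; constructor <;> exact min_eq_left (by linarith)
    refine Susp.homotopicRel (z₀ := suspPt _ _)
      (fun p => Quot.lift (fun x => D.cancel x p.1.2 (min 1 (2 - 2 * p.2))
        (min 1 (2 - 2 * p.2)) (max 0 (1 - 2 * p.2))) (fun x y h => D.cancel_rel h _ _ _ _) p.1.1)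
      ?_ ?_ ?_ ?_ ?_ ?_
    · have := (isQuotientMap_quot_mk (r := s)).continuous_lift_prod_left
        (g := fun p : Quot s × (I × I) => Quot.lift (fun x => D.cancel x p.2.1
          (min 1 (2 - 2 * p.2.2)) (min 1 (2 - 2 * p.2.2)) (max 0 (1 - 2 * p.2.2)))
          (fun x y h => D.cancel_rel h _ _ _ _) p.1) hK
      exact this.comp (f := fun p : (Quot s × I) × I => (p.1.1, (p.1.2, p.2))) (by fun_prop)
    · rintro ⟨x⟩ t
      show D.cancel x ((0 : I) : ℝ) _ _ _ = _
      rw [cancel, if_pos (by simp)]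
      exact Susp.point_of_nonpos _ (by simp)
    · rintro ⟨x⟩ t
      show D.cancel x ((1 : I) : ℝ) _ _ _ = _
      rw [cancel, if_neg (by norm_num), if_neg (by norm_num)]
      exact Susp.point_of_one_le _ (le_max_of_le_left (by norm_num))
    · intro u t
      have key : ∀ y, y = D.i a₀ → Quot.lift (fun x => D.cancel x u (min 1 (2 - 2 * t))
          (min 1 (2 - 2 * t)) (max 0 (1 - 2 * t))) (fun x y h => D.cancel_rel h _ _ _ _) y =
          suspPt _ _ := by
        rintro ⟨x⟩ hx
        exact D.cancel_of_base hx _ _ _ _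
      exact key _ rfl
    · rintro ⟨⟨x⟩, u⟩
      show D.cancel x u (min 1 (2 - 2 * ((0 : I) : ℝ))) (min 1 (2 - 2 * ((0 : I) : ℝ)))
        (max 0 (1 - 2 * ((0 : I) : ℝ))) = _
      have e1 : min 1 (2 - 2 * ((0 : I) : ℝ)) = 1 := by norm_num
      have e2 : max 0 (1 - 2 * ((0 : I) : ℝ)) = 1 := by norm_num
      rw [e1, e2, ← ofTarget_pinch]; rfl
    · rintro ⟨⟨x⟩, u⟩
      show D.cancel x u (min 1 (2 - 2 * ((1 : I) : ℝ))) (min 1 (2 - 2 * ((1 : I) : ℝ)))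
        (max 0 (1 - 2 * ((1 : I) : ℝ))) = _
      have e1 : min 1 (2 - 2 * ((1 : I) : ℝ)) = 0 := by norm_num
      have e2 : max 0 (1 - 2 * ((1 : I) : ℝ)) = 0 := by norm_num
      rw [e1, e2, cancel_zero]; rfl
  · refine Susp.homotopicRel (z₀ := suspPt _ _)
      (fun p => D.pt p.1.1 ((4 * p.1.2 - 3) * (1 - p.2) + p.2 * p.1.2)) ?_ ?_ ?_ ?_ ?_ ?_
    · exact (Susp.continuous_point _).comp (f := fun p : (Quot s × I) × I =>
        (p.1.1, (4 * (p.1.2 : ℝ) - 3) * (1 - p.2) + p.2 * p.1.2)) (by fun_prop)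
    · intro x t
      apply Susp.point_of_nonpos
      have := t.2.2
      simp only [Set.Icc.coe_zero]; linarith
    · intro x t
      apply Susp.point_of_one_le
      simp only [Set.Icc.coe_one]; linarith
    · intro u t; exact Susp.point_base _
    · rintro ⟨x, u⟩
      simp only [Set.Icc.coe_zero, sub_zero, mul_one, zero_mul, add_zero]
      rfl
    · rintro ⟨x, u⟩
      simp only [Set.Icc.coe_one, sub_self, mul_zero, zero_add, one_mul]
      exact Susp.point_coe _ u

/-- The suspension of `X` splits as the wedge of the suspensions of `A` and of `X / A`. -/
theorem splitting :
    PtdHomotopyEquiv (Susp (Quot s) (D.i a₀)) D.Target (suspPt _ _) D.targetPt :=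
  ⟨⟨_, D.continuous_toTarget⟩, ⟨_, D.continuous_ofTarget⟩, D.pinch_nonpos (D.i a₀) le_rfl,
    Susp.mk_zero _, D.ofTarget_toTarget_homotopicRel,
    D.toTarget_ofTarget_homotopicRel⟩

end CollaredRetract

/-! ### Deforming the circle -/

namespace Circle

@[simp] theorem coe_conj (z : Circle) : (z.conj : ℂ) = starRingEnd ℂ z := rfl

@[simp] theorem coe_neg' (z : Circle) : (z.neg : ℂ) = -(z : ℂ) := rfl

@[simp] theorem conj_one : Circle.conj 1 = 1 := by ext; simp

@[simp] theorem conj_conj (z : Circle) : z.conj.conj = z := by ext; simp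

@[simp] theorem neg_neg' (z : Circle) : z.neg.neg = z := by ext; simp

@[fun_prop]
theorem continuous_conj : Continuous Circle.conj :=
  Continuous.subtype_mk (Complex.continuous_conj.comp continuous_subtype_val) _

@[fun_prop]
theorem continuous_neg : Continuous Circle.neg :=
  Continuous.subtype_mk (continuous_subtype_val.neg) _

/-- The direction of a complex number. -/
def dir (z : ℂ) : Circle := Circle.exp z.arg

theorem norm_mul_dir (z : ℂ) : (‖z‖ : ℂ) * dir z = z := by
  rw [dir, Circle.coe_exp, Complex.norm_mul_exp_arg_mul_I]

theorem coe_dir {z : ℂ} (hz : z ≠ 0) : (dir z : ℂ) = z / ‖z‖ := by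
  rw [eq_div_iff (by simpa using hz), mul_comm, norm_mul_dir]

theorem continuous_dir {T : Type} [TopologicalSpace T] {f : T → ℂ} (hf : Continuous f)
    (h : ∀ t, f t ≠ 0) : Continuous fun t => dir (f t) := by
  refine continuous_induced_rng.2 ?_
  have : ((fun z : Circle => (z : ℂ)) ∘ fun t => dir (f t)) = fun t => f t / ‖f t‖ :=
    funext fun t => coe_dir (h t)
  rw [this]
  exact hf.div (by fun_prop) fun t => by simpa using h t

@[simp] theorem dir_coe (z : Circle) : dir z = z := by
  ext; rw [coe_dir (Circle.coe_ne_zero z)]; simp [Circle.norm_coe z]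

theorem dir_conj {z : ℂ} (hz : z ≠ 0) : dir (starRingEnd ℂ z) = (dir z).conj := by
  ext; rw [coe_dir (by simpa using hz), coe_conj, coe_dir hz]; simp

theorem dir_neg {z : ℂ} (hz : z ≠ 0) : dir (-z) = (dir z).neg := by
  ext; rw [coe_dir (by simpa using hz), coe_neg', coe_dir hz]; simp [neg_div]

theorem dir_ofReal_pos {x : ℝ} (hx : 0 < x) : dir (x : ℂ) = 1 := by
  rw [dir, Complex.arg_ofReal_of_nonneg hx.le, Circle.exp_zero]

theorem dir_ofReal_neg {x : ℝ} (hx : x < 0) : dir (x : ℂ) = Circle.neg 1 := by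
  have h : dir (-((-x : ℝ) : ℂ)) = (dir ((-x : ℝ) : ℂ)).neg :=
    dir_neg (by exact_mod_cast (neg_pos.2 hx).ne')
  rw [dir_ofReal_pos (neg_pos.2 hx)] at h
  rw [← h]; simp

theorem re_sq_add_im_sq (z : Circle) : (z : ℂ).re ^ 2 + (z : ℂ).im ^ 2 = 1 := by
  have := z.normSq_coe
  rw [Complex.normSq_apply] at this
  linarith

/-- `y` moved towards `0` by the distance `s / 2`. -/
def shrink (s y : ℝ) : ℝ := y - max (-(min (max s 0) 1) / 2) (min (min (max s 0) 1 / 2) y)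

/-- The flattened vector of which `flat` is the direction. -/
def flatVec (z : Circle) (s : ℝ) : ℂ := ⟨(z : ℂ).re, shrink s (z : ℂ).im⟩

theorem shrink_neg (s y : ℝ) : shrink s (-y) = -shrink s y := by
  unfold shrink
  have h0 : 0 ≤ min (max s 0) 1 := le_min (le_max_right _ _) zero_le_one
  generalize min (max s 0) 1 = u at *
  rcases le_total (u / 2) y with h | h <;> rcases le_total (u / 2) (-y) with h' | h' <;>
    simp only [h, h', min_eq_left, min_eq_right]
  all_goals
    rcases le_total (-u / 2) y with k | k <;> rcases le_total (-u / 2) (-y) with k' | k' <;>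
    rcases le_total (-u / 2) (u / 2) with k'' | k'' <;>
    simp only [k, k', k'', max_eq_left, max_eq_right] <;> linarith

@[simp] theorem shrink_zero_left (y : ℝ) : shrink 0 y = y := by
  unfold shrink
  rcases le_total 0 y with h | h <;> simp [h]

@[simp] theorem shrink_zero_right (s : ℝ) : shrink s 0 = 0 := by
  have := shrink_neg s 0
  rw [neg_zero] at this
  linarith

theorem shrink_one_of_le {y : ℝ} (h : |y| ≤ 1 / 2) : shrink 1 y = 0 := by
  rw [abs_le] at h
  have h2 : -(1 : ℝ) / 2 ≤ y := by linarith
  have h3 : min (1 / 2) y = y := min_eq_right h.2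
  have h4 : max (-1 / 2) y = y := max_eq_right h2
  simp only [shrink, max_eq_left zero_le_one, min_self, h3, h4, sub_self]

theorem flatVec_ne_zero (z : Circle) (s : ℝ) : flatVec z s ≠ 0 := by
  intro h
  have h1 : (z : ℂ).re = 0 := congrArg Complex.re h
  have h2 : shrink s (z : ℂ).im = 0 := congrArg Complex.im h
  have h3 := re_sq_add_im_sq z
  rw [h1] at h3
  unfold shrink at h2
  have h0 : 0 ≤ min (max s 0) 1 := le_min (le_max_right _ _) zero_le_one
  have h1 : min (max s 0) 1 ≤ 1 := min_le_right _ _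
  have h4 : (z : ℂ).im ≤ 1 / 2 := by
    have : max (-(min (max s 0) 1) / 2) (min (min (max s 0) 1 / 2) (z : ℂ).im) ≤ 1 / 2 :=
      max_le (by linarith) ((min_le_left _ _).trans (by linarith))
    linarith
  have h5 : -(1 / 2) ≤ (z : ℂ).im := by
    have := le_max_left (-(min (max s 0) 1) / 2) (min (min (max s 0) 1 / 2) (z : ℂ).im)
    linarith
  nlinarith

/-- A deformation of the circle, odd and equivariant under conjugation, which moves
neighbourhoods of `±1` to `±1`. -/
def flat (z : Circle) (s : ℝ) : Circle := dir (flatVec z s)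

theorem continuous_flat : Continuous fun p : Circle × ℝ => flat p.1 p.2 := by
  refine continuous_dir ?_ fun p => flatVec_ne_zero _ _
  have h : Continuous fun p : Circle × ℝ => ((p.1 : ℂ).re, shrink p.2 (p.1 : ℂ).im) := by
    have h1 : Continuous fun p : Circle × ℝ => (p.1 : ℂ).re :=
      Complex.continuous_re.comp (continuous_subtype_val.comp continuous_fst)
    have h2 : Continuous fun p : Circle × ℝ => (p.1 : ℂ).im :=
      Complex.continuous_im.comp (continuous_subtype_val.comp continuous_fst)
    unfold shrink
    fun_prop
  exact Complex.equivRealProdCLM.symm.continuous.comp h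

theorem flat_zero (z : Circle) : flat z 0 = z := by
  have : flatVec z 0 = z := by simp [flatVec]
  rw [flat, this, dir_coe]

theorem flat_conj (z : Circle) (s : ℝ) : flat z.conj s = (flat z s).conj := by
  have : flatVec z.conj s = starRingEnd ℂ (flatVec z s) := by
    apply Complex.ext <;> simp [flatVec, shrink_neg]
  rw [flat, this, dir_conj (flatVec_ne_zero _ _), flat]

theorem flat_neg (z : Circle) (s : ℝ) : flat z.neg s = (flat z s).neg := by
  have : flatVec z.neg s = -(flatVec z s) := by
    apply Complex.ext <;> simp [flatVec, shrink_neg]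
  rw [flat, this, dir_neg (flatVec_ne_zero _ _), flat]

@[simp] theorem flat_one (s : ℝ) : flat 1 s = 1 := by
  have : flatVec 1 s = ((1 : ℝ) : ℂ) := by
    apply Complex.ext <;> simp [flatVec]
  rw [flat, this, dir_ofReal_pos one_pos]

theorem flat_one_right_of_re_pos {z : Circle} (h : |(z : ℂ).im| ≤ 1 / 2) (h' : 0 < (z : ℂ).re) :
    flat z 1 = 1 := by
  have : flatVec z 1 = ((z : ℂ).re : ℂ) := by
    apply Complex.ext <;> simp [flatVec, shrink_one_of_le h]
  rw [flat, this, dir_ofReal_pos h']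

theorem flat_one_right_of_re_neg {z : Circle} (h : |(z : ℂ).im| ≤ 1 / 2) (h' : (z : ℂ).re < 0) :
    flat z 1 = Circle.neg 1 := by
  have : flatVec z 1 = ((z : ℂ).re : ℂ) := by
    apply Complex.ext <;> simp [flatVec, shrink_one_of_le h]
  rw [flat, this, dir_ofReal_neg h']

theorem flat_one_right_of_dist {z : Circle} (h : 2 * ‖(z : ℂ) - 1‖ < 1) : flat z 1 = 1 := by
  have h1 := Complex.abs_im_le_norm ((z : ℂ) - 1)
  have h2 := (abs_le.1 (Complex.abs_re_le_norm ((z : ℂ) - 1))).1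
  simp at h1 h2
  exact flat_one_right_of_re_pos (by linarith) (by linarith)

theorem norm_conj_sub_one (z : Circle) : ‖starRingEnd ℂ (z : ℂ) - 1‖ = ‖(z : ℂ) - 1‖ := by
  rw [← Complex.norm_conj ((z : ℂ) - 1)]; simp

end Circle

/-! ### Spaces with an involution and a null set -/

/-- A pointed space with a self-map `inv` and a set `null` of points to be collapsed. -/
structure InvSpace where
  carrier : Type
  [top : TopologicalSpace carrier]
  inv : carrier → carrier
  null : Set carrier
  pt : carrier
  pt_mem : pt ∈ null

attribute [instance] InvSpace.top

namespace InvSpace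

/-- Generating relation for the orbit space. -/
def Rel (V : InvSpace) (v w : V.carrier) : Prop := w = V.inv v ∨ (v ∈ V.null ∧ w ∈ V.null)

/-- The orbit space of `V` with the null set collapsed. -/
abbrev Orbit (V : InvSpace) : Type := Quot V.Rel

/-- The class of a point in the orbit space. -/
def cls (V : InvSpace) (v : V.carrier) : V.Orbit := Quot.mk _ v

/-- The orbit space, as a pointed space. -/
def orbit (V : InvSpace) : PtdSpace := { carrier := V.Orbit, pt := V.cls V.pt }

theorem continuous_cls (V : InvSpace) : Continuous V.cls := continuous_quot_mk

theorem cls_inv (V : InvSpace) (v : V.carrier) : V.cls (V.inv v) = V.cls v :=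
  (Quot.sound (r := V.Rel) (Or.inl rfl)).symm

theorem cls_null (V : InvSpace) {v : V.carrier} (h : v ∈ V.null) : V.cls v = V.cls V.pt :=
  Quot.sound (Or.inr ⟨h, V.pt_mem⟩)

/-- Maps out of the orbit space. -/
def lift {V : InvSpace} {Z : Type} (f : V.carrier → Z) (z₀ : Z) (h : ∀ v, f (V.inv v) = f v)
    (h' : ∀ v ∈ V.null, f v = z₀) : V.Orbit → Z :=
  Quot.lift f (by
    rintro v w (rfl | ⟨h1, h2⟩)
    · exact (h v).symm
    · rw [h' v h1, h' w h2])

theorem continuous_lift {V : InvSpace} {Z : Type} [TopologicalSpace Z] {f : V.carrier → Z} {z₀ : Z}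
    {h : ∀ v, f (V.inv v) = f v} {h' : ∀ v ∈ V.null, f v = z₀} (hf : Continuous f) :
    Continuous (lift f z₀ h h') :=
  continuous_quot_lift _ hf

/-- The product of the circle with `V`, the null set being that of `V`, taken over all of the
circle if `b` holds and over `1` otherwise. -/
def plus (b : Prop) (V : InvSpace) : InvSpace where
  carrier := Circle × V.carrier
  inv p := (p.1.conj, V.inv p.2)
  null := {p | p.2 ∈ V.null ∧ (b ∨ p.1 = 1)}
  pt := (1, V.pt)
  pt_mem := ⟨V.pt_mem, Or.inr rfl⟩

/-- The product of the circle with `V`, the null set being the fibre over `1` and, if `b` holds,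
also the null set of `V`. -/
def smash (b : Prop) (V : InvSpace) : InvSpace where
  carrier := Circle × V.carrier
  inv p := (p.1.conj, V.inv p.2)
  null := {p | p.1 = 1 ∨ (b ∧ p.2 ∈ V.null)}
  pt := (1, V.pt)
  pt_mem := Or.inl rfl

/-- `V.orbit` is a retract of `(plus b V).orbit`. -/
def retract (b : Prop) (V : InvSpace) :
    CollaredRetract (plus b V).Rel (V.cls V.pt) where
  i := lift (fun v => (plus b V).cls (1, v)) ((plus b V).cls (1, V.pt))
    (fun v => by
      have := (plus b V).cls_inv (1, v)
      simpa [plus] using this)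
    fun v hv => (plus b V).cls_null (v := ((1 : Circle), v)) ⟨hv, Or.inr rfl⟩
  r := lift (fun p => V.cls p.2) (V.cls V.pt) (fun p => V.cls_inv p.2) fun p hp => V.cls_null hp.1
  ρ q := lift (V := plus b V) (fun p => (plus b V).cls (p.1.flat q.2, p.2)) ((plus b V).cls (1, V.pt))
    (fun p => by
      have := (plus b V).cls_inv (p.1.flat q.2, p.2)
      rw [← this]
      simp [plus, Circle.flat_conj])
    (fun p hp => (plus b V).cls_null (v := (p.1.flat q.2, p.2)) ⟨hp.1, hp.2.imp_right fun h => by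
      rw [h, Circle.flat_one]⟩) q.1
  h p := 2 * ‖(p.1 : ℂ) - 1‖
  continuous_i := continuous_lift ((continuous_cls _).comp
    (f := fun v : V.carrier => ((1 : Circle), v)) (by
      exact Continuous.prodMk_right 1))
  continuous_r := continuous_lift ((continuous_cls V).comp continuous_snd)
  continuous_ρ := by
    refine (isQuotientMap_quot_mk (r := (plus b V).Rel)).continuous_lift_prod_left ?_
    have h : Continuous fun p : (Circle × V.carrier) × ℝ => (p.1.1.flat p.2, p.1.2) :=
      (Circle.continuous_flat.comp
        (f := fun p : (Circle × V.carrier) × ℝ => (p.1.1, p.2)) (by fun_prop)).prodMk (by fun_prop)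
    exact (plus b V).continuous_cls.comp h
  continuous_h := by
    have : Continuous fun p : Circle × V.carrier => (p.1 : ℂ) :=
      continuous_subtype_val.comp continuous_fst
    exact (continuous_const.mul (this.sub continuous_const).norm)
  r_i := by rintro ⟨v⟩; rfl
  ρ_zero := by
    rintro ⟨p⟩
    show (plus b V).cls (p.1.flat 0, p.2) = (plus b V).cls p
    rw [Circle.flat_zero]; rfl
  ρ_i := by
    rintro ⟨v⟩ t
    show (plus b V).cls (Circle.flat 1 t, v) = (plus b V).cls (1, v)
    rw [Circle.flat_one]
  r_ρ := by rintro ⟨p⟩ t; rfl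
  h_rel := by
    rintro p q (rfl | ⟨h1, h2⟩)
    · left; simp [plus, Circle.norm_conj_sub_one]
    · right; exact ⟨(plus b V).cls_null h1, (plus b V).cls_null h2⟩
  h_i := by
    let F : (plus b V).Orbit → Prop := Quot.lift
      (fun p => 2 * ‖(p.1 : ℂ) - 1‖ ≤ 0 ∨ (plus b V).cls p = (plus b V).cls (1, V.pt)) (by
      rintro p q h
      have e : (plus b V).cls p = (plus b V).cls q := Quot.sound h
      rcases h with rfl | ⟨h1, h2⟩
      · simp only [e]; simp [plus, Circle.norm_conj_sub_one]
      · simp only [(plus b V).cls_null h1, (plus b V).cls_null h2]; simp [plus])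
    rintro p ⟨v⟩ h
    have : F ((plus b V).cls (1, v)) := by left; simp
    rw [show (plus b V).cls (1, v) = (plus b V).cls p from h.symm] at this
    exact this
  ρ_one := by
    intro p hp
    show (plus b V).cls (p.1.flat 1, p.2) = (plus b V).cls (1, p.2)
    rw [Circle.flat_one_right_of_dist hp]

end InvSpace

/-- Pointed homotopy equivalence of bundled pointed spaces. -/
def PtdSpace.HEquiv (X Y : PtdSpace) : Prop := PtdHomotopyEquiv X.carrier Y.carrier X.pt Y.pt

namespace PtdSpace.HEquiv

theorem refl (X : PtdSpace) : X.HEquiv X := PtdHomotopyEquiv.refl _ _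

theorem symm {X Y : PtdSpace} (h : X.HEquiv Y) : Y.HEquiv X := PtdHomotopyEquiv.symm h

theorem trans {X Y Z : PtdSpace} (h : X.HEquiv Y) (k : Y.HEquiv Z) : X.HEquiv Z :=
  PtdHomotopyEquiv.trans h k

theorem susp {X Y : PtdSpace} (h : X.HEquiv Y) : X.susp.HEquiv Y.susp := PtdHomotopyEquiv.susp h

theorem wedge {X Y X' Y' : PtdSpace} (h : X.HEquiv X') (k : Y.HEquiv Y') :
    (X.wedge Y).HEquiv (X'.wedge Y') := PtdHomotopyEquiv.wedge h k

theorem susp_wedge (X Y : PtdSpace) : (X.wedge Y).susp.HEquiv (X.susp.wedge Y.susp) :=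
  PtdHomotopyEquiv.susp_wedge

end PtdSpace.HEquiv

namespace InvSpace

/-- The quotient of `(plus b V).orbit` by `V.orbit` is `(smash b V).orbit`. -/
theorem quotient_retract (b : Prop) (V : InvSpace) :
    PtdHomotopyEquiv (retract b V).Quotient (smash b V).Orbit
      ((retract b V).q ((retract b V).i (V.cls V.pt))) ((smash b V).cls (smash b V).pt) := by
  let f : (plus b V).Orbit → (smash b V).Orbit :=
    lift (V := plus b V) (smash b V).cls ((smash b V).cls (smash b V).pt)
      (fun p => (smash b V).cls_inv p)
      fun p hp => (smash b V).cls_null (hp.2.symm.imp_right fun h => ⟨h, hp.1⟩)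
  have hfi : ∀ a, f ((retract b V).i a) = (smash b V).cls (smash b V).pt := by
    rintro ⟨v⟩
    exact (smash b V).cls_null (v := ((1 : Circle), v)) (Or.inl rfl)
  let g : (smash b V).Orbit → (retract b V).Quotient :=
    lift (V := smash b V) (fun p => (retract b V).q ((plus b V).cls p))
      ((retract b V).q ((retract b V).i (V.cls V.pt)))
      (fun p => congrArg _ ((plus b V).cls_inv p)) (by
        rintro ⟨c, v⟩ (h | ⟨h1, h2⟩)
        · simp only at h
          subst h
          exact (retract b V).q_i (V.cls v)
        · exact congrArg _ ((plus b V).cls_null (v := (c, v)) ⟨h2, Or.inl h1⟩))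
  refine PtdHomotopyEquiv.of_inverse
    (Quot.lift f (by rintro _ _ ⟨⟨a, rfl⟩, ⟨a', rfl⟩⟩; rw [hfi, hfi])) g ?_ ?_ ?_ ?_ ?_
  · exact continuous_quot_lift _ (continuous_lift (continuous_cls _))
  · exact continuous_lift ((retract b V).continuous_q.comp (continuous_cls _))
  · exact hfi _
  · rintro ⟨⟨p⟩⟩; rfl
  · rintro ⟨p⟩; rfl

theorem susp_orbit_plus (b : Prop) (V : InvSpace) :
    (plus b V).orbit.susp.HEquiv (V.orbit.susp.wedge (smash b V).orbit.susp) :=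
  ((retract b V).splitting).trans
    ((PtdHomotopyEquiv.refl _ _).wedge (quotient_retract b V).susp)

end InvSpace

/-! ### Wedges of families -/

namespace BigWedge

variable {ι κ : Type}

/-- The inclusion of a summand. -/
def incl (F : ι → PtdSpace) (i : ι) (x : (F i).carrier) : BigWedge F := Quot.mk _ ⟨i, x⟩

theorem continuous_incl (F : ι → PtdSpace) (i : ι) : Continuous (incl F i) :=
  continuous_quot_mk.comp continuous_sigmaMk

theorem incl_pt (F : ι → PtdSpace) (i j : ι) : incl F i (F i).pt = incl F j (F j).pt :=
  Quot.sound ⟨rfl, rfl⟩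

/-- Maps out of the wedge of a family. -/
def lift {F : ι → PtdSpace} {Z : Type} (f : ∀ i, (F i).carrier → Z) (z₀ : Z)
    (h : ∀ i, f i (F i).pt = z₀) : BigWedge F → Z :=
  Quot.lift (fun p => f p.1 p.2) (by
    rintro ⟨i, x⟩ ⟨j, y⟩ ⟨h1, h2⟩
    simp only at h1 h2
    subst h1 h2
    exact (h i).trans (h j).symm)

theorem continuous_lift {F : ι → PtdSpace} {Z : Type} [TopologicalSpace Z]
    {f : ∀ i, (F i).carrier → Z} {z₀ : Z} {h : ∀ i, f i (F i).pt = z₀}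
    (hf : ∀ i, Continuous (f i)) : Continuous (lift f z₀ h) :=
  continuous_quot_lift _ (continuous_sigma hf)

theorem homotopicRel {F : ι → PtdSpace} {Z : Type} [TopologicalSpace Z] {f g : C(BigWedge F, Z)}
    (i₀ : ι) (h : ∀ i, (f.comp ⟨_, continuous_incl F i⟩).HomotopicRel
      (g.comp ⟨_, continuous_incl F i⟩) {(F i).pt}) :
    f.HomotopicRel g {incl F i₀ (F i₀).pt} := by
  choose H hc h0 h1 hb using fun i => (h i).exists_homotopy
  refine ContinuousMap.homotopicRel_of
    (fun p => lift (fun i x => H i (x, p.2)) (f (incl F i₀ (F i₀).pt)) ?_ p.1) ?_ ?_ ?_ ?_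
  · intro i
    rw [hb]
    exact congrArg f (incl_pt F i i₀)
  · refine (isQuotientMap_quot_mk (r := BigWedgeRel F)).continuous_lift_prod_left ?_
    have : Continuous ((fun p : Σ i, (F i).carrier × I => H p.1 p.2) ∘
        Homeomorph.sigmaProdDistrib (X := fun i => (F i).carrier) (Y := I)) :=
      (continuous_sigma hc).comp (Homeomorph.continuous _)
    exact this
  · rintro ⟨i, x⟩; exact h0 i x
  · rintro ⟨i, x⟩; exact h1 i x
  · intro t; exact hb i₀ t

end BigWedge

namespace PtdSpace

variable {ι κ : Type}

/-- The wedge of a family as a pointed space. -/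
def bigWedge (F : ι → PtdSpace) (i₀ : ι) : PtdSpace :=
  { carrier := BigWedge F, pt := BigWedge.incl F i₀ (F i₀).pt }

theorem HEquiv.bigWedge {F G : ι → PtdSpace} (h : ∀ i, (F i).HEquiv (G i)) (i₀ : ι) :
    (bigWedge F i₀).HEquiv (bigWedge G i₀) := by
  choose f g hf hg h1 h2 using h
  refine ⟨⟨BigWedge.lift (fun i x => BigWedge.incl G i (f i x)) (BigWedge.incl G i₀ (G i₀).pt) ?_,
      BigWedge.continuous_lift fun i => (BigWedge.continuous_incl G i).comp (f i).continuous⟩,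
    ⟨BigWedge.lift (fun i x => BigWedge.incl F i (g i x)) (BigWedge.incl F i₀ (F i₀).pt) ?_,
      BigWedge.continuous_lift fun i => (BigWedge.continuous_incl F i).comp (g i).continuous⟩,
    ?_, ?_, ?_, ?_⟩
  · intro i; rw [hf]; exact BigWedge.incl_pt _ _ _
  · intro i; rw [hg]; exact BigWedge.incl_pt _ _ _
  · exact congrArg (BigWedge.incl G i₀) (hf i₀)
  · exact congrArg (BigWedge.incl F i₀) (hg i₀)
  · exact BigWedge.homotopicRel i₀ fun i =>
      (h1 i).comp_continuousMap ⟨_, BigWedge.continuous_incl F i⟩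
  · exact BigWedge.homotopicRel i₀ fun i =>
      (h2 i).comp_continuousMap ⟨_, BigWedge.continuous_incl G i⟩

theorem bigWedge_reindex (e : ι ≃ κ) (G : κ → PtdSpace) (i₀ : ι) (k₀ : κ) :
    (bigWedge (fun i => G (e i)) i₀).HEquiv (bigWedge G k₀) := by
  have key : ∀ (F : ι → PtdSpace) (hF : ∀ k, F (e.symm k) = G k), (∀ i, F i = G (e i)) →
      (bigWedge F i₀).HEquiv (bigWedge G k₀) := by
    intro F hF hF'
    let f : ∀ i, (F i).carrier → (G (e i)).carrier := fun i => cast (by rw [hF'])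
    let g : ∀ k, (G k).carrier → (F (e.symm k)).carrier := fun k => cast (by rw [hF])
    have cast_continuous : ∀ {X Y : PtdSpace} (h : X = Y),
        Continuous (cast (congrArg PtdSpace.carrier h)) := by
      rintro X _ rfl; exact continuous_id
    have cast_pt : ∀ {X Y : PtdSpace} (h : X = Y),
        cast (congrArg PtdSpace.carrier h) X.pt = Y.pt := by
      rintro X _ rfl; rfl
    have incl_cast : ∀ {μ : Type} (H : μ → PtdSpace) {a b : μ} (h : a = b) (x : (H a).carrier) 
        (y : (H b).carrier), HEq x y → BigWedge.incl H a x = BigWedge.incl H b y := by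
      rintro μ H a _ rfl x y h
      rw [eq_of_heq h]
    refine PtdHomotopyEquiv.of_inverse
      (BigWedge.lift (fun i x => BigWedge.incl G (e i) (f i x)) (BigWedge.incl G k₀ (G k₀).pt) ?_)
      (BigWedge.lift (fun k y => BigWedge.incl F (e.symm k) (g k y))
        (BigWedge.incl F i₀ (F i₀).pt) ?_) ?_ ?_ ?_ ?_ ?_
    · intro i
      rw [show f i (F i).pt = (G (e i)).pt from cast_pt (hF' i)]
      exact BigWedge.incl_pt _ _ _
    · intro k
      rw [show g k (G k).pt = (F (e.symm k)).pt from cast_pt (hF k).symm]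
      exact BigWedge.incl_pt _ _ _
    · exact BigWedge.continuous_lift fun i =>
        (BigWedge.continuous_incl _ _).comp (cast_continuous (hF' i))
    · exact BigWedge.continuous_lift fun k =>
        (BigWedge.continuous_incl _ _).comp (cast_continuous (hF k).symm)
    · exact (congrArg (BigWedge.incl G (e i₀)) (cast_pt (hF' i₀))).trans (BigWedge.incl_pt _ _ _)
    · rintro ⟨i, x⟩
      exact incl_cast F (e.symm_apply_apply i) _ _ ((cast_heq _ _).trans (cast_heq _ _))
    · rintro ⟨k, y⟩
      exact incl_cast G (e.apply_symm_apply k) _ _ ((cast_heq _ _).trans (cast_heq _ _))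
  exact key _ (fun k => by rw [e.apply_symm_apply]) fun i => rfl

theorem wedge_bigWedge (F : ι ⊕ κ → PtdSpace) (i₀ : ι) (k₀ : κ) :
    ((bigWedge (fun i => F (Sum.inl i)) i₀).wedge (bigWedge (fun k => F (Sum.inr k)) k₀)).HEquiv
      (bigWedge F (Sum.inl i₀)) := by
  refine PtdHomotopyEquiv.of_inverse
    (Wedge.lift (BigWedge.lift (fun i x => BigWedge.incl F (Sum.inl i) x)
        (BigWedge.incl F (Sum.inl i₀) (F (Sum.inl i₀)).pt) fun i => BigWedge.incl_pt _ _ _)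
      (BigWedge.lift (fun k x => BigWedge.incl F (Sum.inr k) x)
        (BigWedge.incl F (Sum.inl i₀) (F (Sum.inl i₀)).pt) fun i => BigWedge.incl_pt _ _ _)
      (BigWedge.incl_pt F (Sum.inl i₀) (Sum.inr k₀)))
    (BigWedge.lift (fun
        | Sum.inl i => fun x => Wedge.inl _ _ (BigWedge.incl (fun i => F (Sum.inl i)) i x)
        | Sum.inr k => fun x => Wedge.inr _ _ (BigWedge.incl (fun k => F (Sum.inr k)) k x))
      (wedgePt _ _ _ _) ?_) ?_ ?_ ?_ ?_ ?_
  · rintro (i | k)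
    · exact congrArg (Wedge.inl _ _) (BigWedge.incl_pt (fun i => F (Sum.inl i)) i i₀)
    · exact (congrArg (Wedge.inr _ _) (BigWedge.incl_pt (fun k => F (Sum.inr k)) k k₀)).trans
        Wedge.inr_base
  · exact Wedge.continuous_lift
      (BigWedge.continuous_lift fun i => BigWedge.continuous_incl F (Sum.inl i))
      (BigWedge.continuous_lift fun k => BigWedge.continuous_incl F (Sum.inr k))
  · refine BigWedge.continuous_lift ?_
    rintro (i | k)
    · exact Wedge.continuous_inl.comp (BigWedge.continuous_incl _ i)
    · exact Wedge.continuous_inr.comp (BigWedge.continuous_incl _ k)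
  · rfl
  · refine Wedge.ind ?_ ?_
    · rintro ⟨i, x⟩; rfl
    · rintro ⟨i, x⟩; rfl
  · rintro ⟨i | k, x⟩ <;> rfl

theorem bigWedge_unit (F : Unit → PtdSpace) : (F ()).HEquiv (bigWedge F ()) :=
  PtdHomotopyEquiv.of_inverse (BigWedge.incl F ())
    (BigWedge.lift (fun _ x => x) (F ()).pt fun _ => rfl) (BigWedge.continuous_incl _ _)
    (BigWedge.continuous_lift fun _ => continuous_id) rfl (fun _ => rfl) (by rintro ⟨i, x⟩; rfl)

end PtdSpace

/-! ### Splitting iterated products with circles -/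

namespace InvSpace

/-- Isomorphism of spaces with an involution and a null set. -/
structure Iso (V W : InvSpace) where
  toFun : V.carrier → W.carrier
  invFun : W.carrier → V.carrier
  continuous_toFun : Continuous toFun
  continuous_invFun : Continuous invFun
  left_inv : ∀ v, invFun (toFun v) = v
  right_inv : ∀ w, toFun (invFun w) = w
  map_inv : ∀ v, toFun (V.inv v) = W.inv (toFun v)
  mem_null : ∀ v, toFun v ∈ W.null ↔ v ∈ V.null
  map_pt : toFun V.pt = W.pt

namespace Iso

/-- The identity isomorphism. -/
def refl (V : InvSpace) : Iso V V :=
  ⟨id, id, continuous_id, continuous_id, fun _ => rfl, fun _ => rfl, fun _ => rfl,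
    fun _ => Iff.rfl, rfl⟩

/-- Composition of isomorphisms. -/
def trans {U V W : InvSpace} (e : Iso U V) (f : Iso V W) : Iso U W where
  toFun := f.toFun ∘ e.toFun
  invFun := e.invFun ∘ f.invFun
  continuous_toFun := f.continuous_toFun.comp e.continuous_toFun
  continuous_invFun := e.continuous_invFun.comp f.continuous_invFun
  left_inv v := by simp [f.left_inv, e.left_inv]
  right_inv v := by simp [f.right_inv, e.right_inv]
  map_inv v := by simp [f.map_inv, e.map_inv]
  mem_null v := by simp [f.mem_null, e.mem_null]
  map_pt := by simp [f.map_pt, e.map_pt]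

theorem orbit {V W : InvSpace} (e : Iso V W) : V.orbit.HEquiv W.orbit := by
  refine PtdHomotopyEquiv.of_inverse
    (lift (fun v => W.cls (e.toFun v)) (W.cls W.pt) ?_ ?_)
    (lift (fun w => V.cls (e.invFun w)) (V.cls V.pt) ?_ ?_) ?_ ?_ ?_ ?_ ?_
  · intro v; rw [e.map_inv, cls_inv]
  · intro v hv; exact W.cls_null ((e.mem_null v).2 hv)
  · intro w
    rw [← V.cls_inv (e.invFun w), ← e.left_inv (V.inv _), e.map_inv, e.right_inv]
  · intro w hw
    exact V.cls_null ((e.mem_null _).1 (by rwa [e.right_inv]))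
  · exact continuous_lift (W.continuous_cls.comp e.continuous_toFun)
  · exact continuous_lift (V.continuous_cls.comp e.continuous_invFun)
  · exact congrArg W.cls e.map_pt
  · rintro ⟨v⟩; exact congrArg V.cls (e.left_inv v)
  · rintro ⟨w⟩; exact congrArg W.cls (e.right_inv w)

/-- The functoriality of `plus`. -/
def plus (b : Prop) {V W : InvSpace} (e : Iso V W) : Iso (plus b V) (InvSpace.plus b W) where
  toFun p := (p.1, e.toFun p.2)
  invFun p := (p.1, e.invFun p.2)
  continuous_toFun := continuous_fst.prodMk (e.continuous_toFun.comp continuous_snd)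
  continuous_invFun := continuous_fst.prodMk (e.continuous_invFun.comp continuous_snd)
  left_inv _ := Prod.ext rfl (e.left_inv _)
  right_inv _ := Prod.ext rfl (e.right_inv _)
  map_inv _ := Prod.ext rfl (e.map_inv _)
  mem_null p := and_congr_left' (e.mem_null p.2)
  map_pt := Prod.ext rfl e.map_pt

/-- Exchanging the two circle factors. -/
def swap (b : Prop) (V : InvSpace) :
    Iso (smash b (InvSpace.plus b V)) (InvSpace.plus True (smash b V)) where
  toFun p := (p.2.1, (p.1, p.2.2))
  invFun p := (p.2.1, (p.1, p.2.2))
  continuous_toFun := by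
    have h : Continuous fun p : Circle × Circle × V.carrier => (p.2.1, (p.1, p.2.2)) := by fun_prop
    exact h
  continuous_invFun := by
    have h : Continuous fun p : Circle × Circle × V.carrier => (p.2.1, (p.1, p.2.2)) := by fun_prop
    exact h
  left_inv _ := rfl
  right_inv _ := rfl
  map_inv _ := rfl
  mem_null p := by
    show (p.1 = 1 ∨ (b ∧ p.2.2 ∈ V.null)) ∧ (True ∨ p.2.1 = 1) ↔
      p.1 = 1 ∨ (b ∧ (p.2.2 ∈ V.null ∧ (b ∨ p.2.1 = 1)))
    tauto
  map_pt := rfl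

end Iso

/-- Iteration of `plus b`. -/
def plusIter (b : Prop) : ℕ → InvSpace → InvSpace
  | 0, V => V
  | k + 1, V => plus b (plusIter b k V)

/-- `smash b` followed by `d - 1` applications of `smash True`. -/
def smashIter : ℕ → Prop → InvSpace → InvSpace
  | 0, _, V => V
  | d + 1, b, V => smashIter d True (smash b V)

theorem smashIter_succ (d : ℕ) (V : InvSpace) :
    smashIter (d + 1) True V = smash True (smashIter d True V) := by
  induction d generalizing V with
  | zero => rfl
  | succ d ih => exact ih (smash True V)

/-- `smash` commutes with the iteration of `plus`. -/
def smashPlusIter (b : Prop) (V : InvSpace) :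
    (k : ℕ) → Iso (smash b (plusIter b k V)) (plusIter True k (smash b V))
  | 0 => Iso.refl _
  | k + 1 => (Iso.swap b (plusIter b k V)).trans ((smashPlusIter b V k).plus True)

/-- The subsets of a `k`-element set. -/
def CubeIndex : ℕ → Type
  | 0 => Unit
  | k + 1 => CubeIndex k ⊕ CubeIndex k

/-- The cardinality of a subset. -/
def CubeIndex.weight : {k : ℕ} → CubeIndex k → ℕ
  | 0, _ => 0
  | _ + 1, Sum.inl j => weight j
  | _ + 1, Sum.inr j => weight j + 1

/-- The empty subset. -/
def CubeIndex.bot : (k : ℕ) → CubeIndex k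
  | 0 => ()
  | k + 1 => Sum.inl (bot k)

theorem susp_orbit_plusIter (k : ℕ) (b : Prop) (V : InvSpace) :
    (plusIter b k V).orbit.susp.HEquiv
      (PtdSpace.bigWedge (fun j : CubeIndex k => (smashIter j.weight b V).orbit.susp)
        (CubeIndex.bot k)) := by
  induction k generalizing b V with
  | zero => exact PtdSpace.bigWedge_unit fun _ => V.orbit.susp
  | succ k ih =>
    refine (susp_orbit_plus b (plusIter b k V)).trans ?_
    refine ((ih b V).wedge ((smashPlusIter b V k).orbit.susp.trans (ih True (smash b V)))).trans ?_
    exact PtdSpace.wedge_bigWedge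
      (fun j : CubeIndex k ⊕ CubeIndex k =>
        (smashIter (CubeIndex.weight (k := k + 1) j) b V).orbit.susp) _ _

end InvSpace

/-! ### The Klein bottle -/

theorem PtdHomotopyEquiv.of_bijective {X Y : Type} [TopologicalSpace X] [TopologicalSpace Y]
    [CompactSpace X] [T2Space Y] {x₀ : X} {y₀ : Y} (f : X → Y) (hf : Continuous f)
    (hb : Function.Bijective f) (h₀ : f x₀ = y₀) : PtdHomotopyEquiv X Y x₀ y₀ := by
  let e : X ≃ₜ Y := Continuous.homeoOfEquivCompactToT2 (f := Equiv.ofBijective f hb) hf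
  exact of_inverse e e.symm e.continuous e.symm.continuous h₀ e.symm_apply_apply
    e.apply_symm_apply

namespace Circle

theorem exists_mul_self_eq (z : Circle) : ∃ w : Circle, w * w = z :=
  ⟨Circle.exp (Complex.arg z / 2), by rw [← Circle.exp_add, add_halves, Circle.exp_arg]⟩

theorem neg_mul_neg' (z w : Circle) : z.neg * w.neg = z * w := by ext; simp

theorem mul_self_eq_iff {z w : Circle} : z * z = w * w ↔ z = w ∨ z = w.neg := by
  rw [Circle.ext_iff, Circle.ext_iff, Circle.ext_iff]
  simpa using mul_self_eq_mul_self_iff (a := (z : ℂ)) (b := w)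

theorem isQuotientMap_mul_self : IsQuotientMap fun z : Circle => z * z :=
  IsQuotientMap.of_surjective_continuous exists_mul_self_eq (by fun_prop)

end Circle

namespace InvSpace

/-- The circle with the antipodal involution. -/
def antipodal : InvSpace where
  carrier := Circle
  inv := Circle.neg
  null := {1}
  pt := (1 : Circle)
  pt_mem := rfl

theorem antipodal_orbit : antipodal.orbit.HEquiv (SphP 0) := by
  have : CompactSpace antipodal.Orbit :=
    Quot.compactSpace (X := Circle)
  refine PtdHomotopyEquiv.of_bijective (X := antipodal.Orbit) (Y := Circle)
    (lift (V := antipodal) (fun z : Circle => z * z) 1 (fun z => Circle.neg_mul_neg' z z)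
      (by rintro _ rfl; exact one_mul _))
    (continuous_lift Circle.isQuotientMap_mul_self.continuous) ⟨?_, ?_⟩ (one_mul _)
  · rintro ⟨z⟩ ⟨w⟩ h
    rcases Circle.mul_self_eq_iff.1 h with rfl | rfl
    · rfl
    · exact antipodal.cls_inv w
  · intro z
    obtain ⟨w, hw⟩ := Circle.exists_mul_self_eq z
    exact ⟨antipodal.cls w, hw⟩

/-- The coordinates of a point of an iterated product with circles. -/
def toTorus : (k : ℕ) → (plusIter False k antipodal).carrier → Torus (k + 1)
  | 0, z => fun _ => z
  | k + 1, p => Fin.cons (α := fun _ => Circle) p.1 (toTorus k p.2)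

/-- The point of an iterated product of circles with given coordinates. -/
def ofTorus : (k : ℕ) → Torus (k + 1) → (plusIter False k antipodal).carrier
  | 0, t => t 0
  | k + 1, t => (t 0, ofTorus k (Fin.tail t))

theorem continuous_toTorus : (k : ℕ) → Continuous (toTorus k)
  | 0 => continuous_pi fun _ => continuous_id
  | k + 1 => by
    have h := continuous_toTorus k
    refine continuous_pi fun i => ?_
    refine Fin.cases ?_ (fun i => ?_) i
    · exact continuous_fst
    · exact (continuous_apply i).comp (h.comp continuous_snd)

theorem continuous_ofTorus : (k : ℕ) → Continuous (ofTorus k)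
  | 0 => continuous_apply _
  | k + 1 => (continuous_apply _).prodMk ((continuous_ofTorus k).comp
      (continuous_pi fun _ => continuous_apply _))

theorem ofTorus_toTorus : (k : ℕ) → ∀ v, ofTorus k (toTorus k v) = v
  | 0, _ => rfl
  | k + 1, p => Prod.ext rfl (ofTorus_toTorus k p.2)

theorem toTorus_ofTorus : (k : ℕ) → ∀ t, toTorus k (ofTorus k t) = t
  | 0, t => funext fun i => congrArg t (Subsingleton.elim (α := Fin 1) _ _)
  | k + 1, t => by
    show Fin.cons (α := fun _ => Circle) (t 0) (toTorus k (ofTorus k (Fin.tail t))) = t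
    rw [toTorus_ofTorus k, Fin.cons_self_tail]

theorem toTorus_inv : (k : ℕ) → ∀ v, toTorus k ((plusIter False k antipodal).inv v) =
    kleinInvolution (k + 1) (toTorus k v)
  | 0, v => by
    funext i
    fin_cases i
    simp [kleinInvolution, toTorus, plusIter, antipodal]
  | k + 1, p => by
    funext i
    have ih := congrFun (toTorus_inv k p.2)
    refine Fin.cases ?_ (fun i => ?_) i
    · simp [kleinInvolution, toTorus, plusIter, plus]
    · refine (ih i).trans ?_
      simp [kleinInvolution, toTorus]

theorem toTorus_pt : (k : ℕ) → toTorus k (plusIter False k antipodal).pt = fun _ => 1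
  | 0 => rfl
  | k + 1 => by
    funext i
    refine Fin.cases rfl (fun i => ?_) i
    exact congrFun (toTorus_pt k) i

theorem eq_pt_of_mem_null : (k : ℕ) → ∀ v ∈ (plusIter False k antipodal).null,
    v = (plusIter False k antipodal).pt
  | 0, _, h => h
  | k + 1, _, h => Prod.ext (h.2.resolve_left id) (eq_pt_of_mem_null k _ h.1)

theorem klein_hEquiv (k : ℕ) :
    PtdHomotopyEquiv (Klein (k + 1)) (plusIter False k antipodal).Orbit (kleinBase (k + 1))
      (plusIter False k antipodal).orbit.pt := by
  let V := plusIter False k antipodal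
  have hinv : ∀ t, ofTorus k (kleinInvolution (k + 1) t) = V.inv (ofTorus k t) := by
    intro t
    have := toTorus_inv k (ofTorus k t)
    rw [toTorus_ofTorus] at this
    rw [← this, ofTorus_toTorus]
  refine PtdHomotopyEquiv.of_inverse
    (Quot.lift (fun t => V.cls (ofTorus k t)) ?_)
    (lift (fun v => Quot.mk _ (toTorus k v)) (kleinBase (k + 1)) ?_ ?_) ?_ ?_ ?_ ?_ ?_
  · rintro t _ rfl
    rw [hinv, cls_inv]
  · intro v
    rw [toTorus_inv]
    exact (Quot.sound (r := KleinRel (k + 1)) rfl).symm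
  · intro v hv
    rw [eq_pt_of_mem_null k v hv, toTorus_pt]; rfl
  · exact continuous_quot_lift _ (V.continuous_cls.comp (continuous_ofTorus k))
  · exact continuous_lift (continuous_quot_mk.comp (continuous_toTorus k))
  · show V.cls (ofTorus k fun _ => 1) = V.cls V.pt
    rw [← toTorus_pt, ofTorus_toTorus]
  · rintro ⟨t⟩; exact congrArg (Quot.mk _) (toTorus_ofTorus k t)
  · rintro ⟨v⟩; exact congrArg V.cls (ofTorus_toTorus k v)

end InvSpace

/-! ### Mapping cones -/

namespace MCone

variable {A B Z : Type} [TopologicalSpace A] [TopologicalSpace B] [TopologicalSpace Z]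
  {a₀ : A} {b₀ : B} {φ : A → B}

/-- The inclusion of the cone. -/
def inl (a₀ : A) (φ : A → B) (p : A × I) : MCone a₀ φ := Quot.mk _ (Sum.inl p)

/-- The inclusion of the target. -/
def inr (a₀ : A) (φ : A → B) (b : B) : MCone a₀ φ := Quot.mk _ (Sum.inr b)

theorem continuous_inl : Continuous (inl a₀ φ) := _root_.continuous_quot_mk.comp _root_.continuous_inl

theorem continuous_inr : Continuous (inr a₀ φ) := _root_.continuous_quot_mk.comp _root_.continuous_inr

theorem inl_one (a : A) : inl a₀ φ (a, 1) = inr a₀ φ (φ a) := Quot.sound ⟨rfl, rfl⟩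

theorem inl_base (h : φ a₀ = b₀) (s : I) : inl a₀ φ (a₀, s) = mconePt a₀ φ b₀ := by
  have : inl a₀ φ (a₀, s) = inl a₀ φ (a₀, 1) := Quot.sound (Or.inr ⟨rfl, rfl⟩)
  rw [this, inl_one, h]; rfl

theorem inl_zero (h : φ a₀ = b₀) (a : A) : inl a₀ φ (a, 0) = mconePt a₀ φ b₀ := by
  rw [← inl_base h 0]
  exact Quot.sound (Or.inl ⟨rfl, rfl⟩)

/-- Maps out of a mapping cone. -/
def lift (f : A × I → Z) (g : B → Z) (z₀ : Z) (h0 : ∀ a, f (a, 0) = z₀) (hb : ∀ s, f (a₀, s) = z₀)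
    (h1 : ∀ a, f (a, 1) = g (φ a)) : MCone a₀ φ → Z :=
  Quot.lift (Sum.elim f g) (by
    rintro (⟨a, s⟩ | b) (⟨a', s'⟩ | b') h
    · rcases h with ⟨h, h'⟩ | ⟨h, h'⟩ <;> simp only at h h' <;> subst h <;> subst h'
      · exact (h0 _).trans (h0 _).symm
      · exact (hb _).trans (hb _).symm
    · obtain ⟨h, rfl⟩ := h
      simp only at h
      subst h
      exact h1 a
    · exact h.elim
    · exact h.elim)

theorem continuous_lift {f : A × I → Z} {g : B → Z} {z₀ : Z} {h0 : ∀ a, f (a, 0) = z₀}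
    {hb : ∀ s, f (a₀, s) = z₀} {h1 : ∀ a, f (a, 1) = g (φ a)} (hf : Continuous f)
    (hg : Continuous g) : Continuous (lift f g z₀ h0 hb h1) :=
  continuous_quot_lift _ (hf.sumElim hg)

theorem ind {p : MCone a₀ φ → Prop} (hl : ∀ x, p (inl a₀ φ x)) (hr : ∀ b, p (inr a₀ φ b)) :
    ∀ x, p x := by
  rintro ⟨x | b⟩
  · exact hl x
  · exact hr b

/-- Suspension commutes with mapping cones. -/
theorem susp (h : φ a₀ = b₀) :
    PtdHomotopyEquiv (MCone (suspPt A a₀) (suspMap a₀ b₀ φ h)) (Susp (MCone a₀ φ) (mconePt a₀ φ b₀))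
      (mconePt _ _ (suspPt B b₀)) (suspPt _ _) := by
  have hs : suspMap a₀ b₀ φ h (suspPt A a₀) = suspPt B b₀ := by
    show Quot.mk _ (φ a₀, (0 : I)) = _
    rw [h]; rfl
  let inner (s : I) : Susp A a₀ → Susp (MCone a₀ φ) (mconePt a₀ φ b₀) :=
    Susp.lift (suspPt _ _) (fun q => Quot.mk _ (inl a₀ φ (q.1, s), q.2)) (fun _ => Susp.mk_zero _)
      (fun _ => Susp.mk_one _) (fun u => by simp only [inl_base h]; exact Susp.mk_base u)
  let f : MCone (suspPt A a₀) (suspMap a₀ b₀ φ h) → Susp (MCone a₀ φ) (mconePt a₀ φ b₀) :=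
    lift (fun p => inner p.2 p.1) (suspMap _ _ (inr a₀ φ) rfl) (suspPt _ _)
      (by
        rintro ⟨a, u⟩
        show (Quot.mk _ (inl a₀ φ (a, 0), u) : Susp (MCone a₀ φ) (mconePt a₀ φ b₀)) = _
        rw [inl_zero h]; exact Susp.mk_base u)
      (fun s => Susp.mk_zero _)
      (by
        rintro ⟨a, u⟩
        show (Quot.mk _ (inl a₀ φ (a, 1), u) : Susp (MCone a₀ φ) (mconePt a₀ φ b₀)) = _
        rw [inl_one]; rfl)
  let gin (u : I) : MCone a₀ φ → MCone (suspPt A a₀) (suspMap a₀ b₀ φ h) :=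
    lift (fun q => inl _ _ (Quot.mk _ (q.1, u), q.2)) (fun b => inr _ _ (Quot.mk _ (b, u)))
      (mconePt _ _ (suspPt B b₀)) (fun _ => inl_zero hs _)
      (fun s => by simp only [Susp.mk_base]; exact inl_base hs s) (fun a => inl_one _)
  let g : Susp (MCone a₀ φ) (mconePt a₀ φ b₀) → MCone (suspPt A a₀) (suspMap a₀ b₀ φ h) :=
    Susp.lift (mconePt _ _ (suspPt B b₀)) (fun p => gin p.2 p.1)
      (ind (fun p => by
          show inl _ _ (Quot.mk _ (p.1, (0 : I)), p.2) = _
          rw [Susp.mk_zero]; exact inl_base hs _)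
        fun b => by
          show inr _ _ (Quot.mk _ (b, (0 : I))) = _
          rw [Susp.mk_zero]; rfl)
      (ind (fun p => by
          show inl _ _ (Quot.mk _ (p.1, (1 : I)), p.2) = _
          rw [Susp.mk_one]; exact inl_base hs _)
        fun b => by
          show inr _ _ (Quot.mk _ (b, (1 : I))) = _
          rw [Susp.mk_one]; rfl)
      (fun u => by
          show inr _ _ (Quot.mk _ (b₀, u)) = _
          rw [Susp.mk_base]; rfl)
  refine PtdHomotopyEquiv.of_inverse f g ?_ ?_ ?_ ?_ ?_
  · refine continuous_lift ?_ (continuous_suspMap _ continuous_inr)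
    refine (isQuotientMap_susp_mk a₀).continuous_lift_prod_left
      (g := fun p : Susp A a₀ × I => inner p.2 p.1) ?_
    exact continuous_quot_mk.comp ((continuous_inl.comp (by fun_prop)).prodMk (by fun_prop))
  · refine Susp.continuous_lift ((isQuotientMap_quot_mk (r := ConeRel a₀ φ)).continuous_lift_prod_left
      (g := fun p : MCone a₀ φ × I => gin p.2 p.1) ?_)
    have hl : Continuous fun p : (A × I) × I =>
        inl (suspPt A a₀) (suspMap a₀ b₀ φ h) (Quot.mk _ (p.1.1, p.2), p.1.2) :=
      continuous_inl.comp ((continuous_quot_mk.comp (by fun_prop)).prodMk (by fun_prop))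
    have hr : Continuous fun p : B × I =>
        inr (suspPt A a₀) (suspMap a₀ b₀ φ h) (Quot.mk _ p) :=
      continuous_inr.comp continuous_quot_mk
    convert (hl.sumElim hr).comp (Homeomorph.sumProdDistrib (X := A × I) (Y := B) (Z := I)).continuous
      using 1
    ext ⟨x | y, t⟩ <;> rfl
  · exact Susp.mk_zero _
  · refine ind ?_ ?_
    · rintro ⟨⟨a, u⟩, s⟩; rfl
    · rintro ⟨b, u⟩; rfl
  · rintro ⟨x, u⟩
    revert x
    exact ind (fun _ => rfl) fun _ => rfl

theorem isQuotientMap_inl (hq : IsQuotientMap φ) : IsQuotientMap (inl a₀ φ) := by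
  refine (isQuotientMap_iff _).2 ⟨isCoinducing_iff.2 fun s => ⟨fun hs => ?_, fun hs => ?_⟩, ?_⟩
  · refine isOpen_coinduced.2 (isOpen_sum_iff.2 ⟨hs, ?_⟩)
    refine hq.isOpen_preimage.1 ?_
    have h : IsOpen ((fun a => ((a, 1) : A × I)) ⁻¹' (inl a₀ φ ⁻¹' s)) := hs.preimage (by fun_prop)
    convert h using 1
    ext a
    show inr a₀ φ (φ a) ∈ s ↔ inl a₀ φ (a, 1) ∈ s
    rw [inl_one]
  · exact hs.preimage continuous_inl
  · refine ind (fun x => ⟨x, rfl⟩) fun b => ?_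
    obtain ⟨a, rfl⟩ := hq.surjective b
    exact ⟨(a, 1), inl_one a⟩

end MCone

theorem moore_susp (m : ℕ) : (MooreP m).susp.HEquiv (MooreP (m + 1)) :=
  (MCone.susp (degTwo m).2).symm

/-! ### The smash product of the circle and the antipodal circle -/

namespace Circle

theorem re_le_one (z : Circle) : (z : ℂ).re ≤ 1 := by
  nlinarith [re_sq_add_im_sq z, sq_nonneg (z : ℂ).im]

theorem neg_one_le_re (z : Circle) : -1 ≤ (z : ℂ).re := by
  nlinarith [re_sq_add_im_sq z, sq_nonneg (z : ℂ).im]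

theorem abs_im_le_one (z : Circle) : |(z : ℂ).im| ≤ 1 := by
  rw [abs_le]
  constructor <;> nlinarith [re_sq_add_im_sq z, sq_nonneg (z : ℂ).re]

@[fun_prop]
theorem continuous_re : Continuous fun z : Circle => (z : ℂ).re :=
  Complex.continuous_re.comp continuous_subtype_val

@[fun_prop]
theorem continuous_im : Continuous fun z : Circle => (z : ℂ).im :=
  Complex.continuous_im.comp continuous_subtype_val

/-- The normalized distance to `1` along the real axis. -/
def height (c : Circle) : I :=
  ⟨(1 - (c : ℂ).re) / 2, by
    constructor <;> linarith [re_le_one c, neg_one_le_re c]⟩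

theorem coe_height (c : Circle) : (height c : ℝ) = (1 - (c : ℂ).re) / 2 := rfl

@[fun_prop]
theorem continuous_height : Continuous height :=
  Continuous.subtype_mk (by fun_prop) _

@[simp] theorem height_conj (c : Circle) : height c.conj = height c := by
  ext; simp [coe_height]

@[simp] theorem height_one : height 1 = 0 := by ext; simp [coe_height]

theorem height_eq_of_im_eq_zero {c : Circle} (h : (c : ℂ).im = 0) : height c = 0 ∨ height c = 1 := by
  have h1 := re_sq_add_im_sq c
  rw [h] at h1
  have h2 : ((c : ℂ).re - 1) * ((c : ℂ).re + 1) = 0 := by linarith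
  rcases mul_eq_zero.1 h2 with h3 | h3
  · left; ext; rw [coe_height]; simp; linarith
  · right; ext; rw [coe_height]; simp; linarith

theorem eq_one_of_height {c : Circle} (h : height c = 0) : c = 1 := by
  have h1 := re_sq_add_im_sq c
  have h2 : (1 - (c : ℂ).re) / 2 = 0 := congrArg Subtype.val h
  have h3 : (c : ℂ).re = 1 := by linarith
  rw [h3] at h1
  ext
  apply Complex.ext
  · simpa using h3
  · simpa using h1

/-- The point of the upper half circle of given height. -/
def upper (s : I) : Circle :=
  ⟨⟨1 - 2 * s, 2 * Real.sqrt (s * (1 - s))⟩, by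
    have h : (0 : ℝ) ≤ s * (1 - s) := mul_nonneg s.2.1 (by linarith [s.2.2])
    refine mem_sphere_zero_iff_norm.2 ?_
    rw [← sq_eq_sq₀ (norm_nonneg _) zero_le_one, ← Complex.normSq_eq_norm_sq, Complex.normSq_apply]
    simp only
    nlinarith [Real.mul_self_sqrt h]⟩

theorem re_upper (s : I) : (upper s : ℂ).re = 1 - 2 * s := rfl

theorem im_upper (s : I) : (upper s : ℂ).im = 2 * Real.sqrt (s * (1 - s)) := rfl

@[fun_prop]
theorem continuous_upper : Continuous upper := by
  refine Continuous.subtype_mk ?_ _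
  have h : Continuous fun s : I => ((1 - 2 * s : ℝ), 2 * Real.sqrt (s * (1 - s))) := by fun_prop
  exact Complex.equivRealProdCLM.symm.continuous.comp h

theorem im_upper_nonneg (s : I) : 0 ≤ (upper s : ℂ).im := by rw [im_upper]; positivity

@[simp] theorem height_upper (s : I) : height (upper s) = s := by
  ext; rw [coe_height, re_upper]; ring

theorem upper_height {c : Circle} (h : 0 ≤ (c : ℂ).im) : upper (height c) = c := by
  ext
  apply Complex.ext
  · rw [re_upper, coe_height]; ring
  · rw [im_upper, coe_height]
    have h1 := re_sq_add_im_sq c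
    rw [show (1 - (c : ℂ).re) / 2 * (1 - (1 - (c : ℂ).re) / 2) = ((c : ℂ).im / 2) ^ 2 by nlinarith,
      Real.sqrt_sq (by linarith)]
    ring

@[simp] theorem upper_zero : upper 0 = 1 := eq_one_of_height (height_upper 0)

theorem upper_one : upper 1 = Circle.neg 1 := by
  ext
  apply Complex.ext
  · rw [re_upper]; simp; norm_num
  · rw [im_upper]; simp

end Circle

namespace InvSpace

/-- The smash product of the circle and the antipodal circle, parametrized by the cone on the
circle. -/
def cross (p : Circle × I) : (smash False antipodal).Orbit :=
  (smash False antipodal).cls (Circle.upper p.2, p.1)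

theorem continuous_cross : Continuous cross :=
  (smash False antipodal).continuous_cls.comp
    (f := fun p : Circle × I => (Circle.upper p.2, p.1)) (by fun_prop)

theorem cross_zero (a : Circle) : cross (a, 0) = (smash False antipodal).orbit.pt :=
  (smash False antipodal).cls_null (v := (Circle.upper 0, a)) (Or.inl Circle.upper_zero)

theorem cross_one_neg (a : Circle) : cross (a.neg, 1) = cross (a, 1) := by
  have := (smash False antipodal).cls_inv (Circle.upper 1, a)
  rw [cross, cross, ← this]
  simp only [smash, antipodal]
  congr 2
  rw [Circle.upper_one]
  ext; simp

/-- Maps out of the smash product of the circle and the antipodal circle. -/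
def crossLift {Z : Type} (F : Circle × I → Z) (z₀ : Z) (h0 : ∀ a, F (a, 0) = z₀)
    (h1 : ∀ a : Circle, F (a.neg, 1) = F (a, 1)) : (smash False antipodal).Orbit → Z :=
  lift (V := smash False antipodal)
    (fun p : Circle × Circle => if 0 ≤ (p.1 : ℂ).im then F (p.2, p.1.height)
      else F (p.2.neg, p.1.height)) z₀
    (by
      intro p
      obtain ⟨c, z⟩ : Circle × Circle := p
      show (if 0 ≤ (c.conj : ℂ).im then F (z.neg, c.conj.height)
        else F (z.neg.neg, c.conj.height)) = if 0 ≤ (c : ℂ).im then F (z, c.height)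
          else F (z.neg, c.height)
      rw [Circle.height_conj, Circle.neg_neg', Circle.coe_conj, Complex.conj_im]
      rcases lt_trichotomy 0 (c : ℂ).im with h | h | h
      · rw [if_neg (by linarith), if_pos h.le]
      · rw [← h, neg_zero, if_pos le_rfl, if_pos le_rfl]
        rcases Circle.height_eq_of_im_eq_zero h.symm with h | h <;> rw [h]
        · rw [h0, h0]
        · rw [h1]
      · rw [if_pos (by linarith), if_neg (by linarith)])
    (by
      intro p h
      obtain ⟨c, z⟩ : Circle × Circle := p
      rcases h with h | h
      · obtain rfl : c = 1 := h
        show (if 0 ≤ ((1 : Circle) : ℂ).im then F (z, Circle.height 1)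
          else F (z.neg, Circle.height 1)) = z₀
        rw [Circle.height_one]; simp only [h0, ite_self]
      · exact h.1.elim)

section

variable {Z : Type} {F : Circle × I → Z} {z₀ : Z} {h0 : ∀ a, F (a, 0) = z₀}
  {h1 : ∀ a : Circle, F (a.neg, 1) = F (a, 1)}

theorem crossLift_cross (p : Circle × I) : crossLift F z₀ h0 h1 (cross p) = F p := by
  show (if 0 ≤ (Circle.upper p.2 : ℂ).im then F (p.1, (Circle.upper p.2).height)
      else F (p.1.neg, (Circle.upper p.2).height)) = F p
  rw [if_pos (Circle.im_upper_nonneg _), Circle.height_upper]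

theorem continuous_crossLift [TopologicalSpace Z] (hF : Continuous F) :
    Continuous (crossLift F z₀ h0 h1) := by
  refine continuous_lift (V := smash False antipodal) ?_
  show Continuous fun p : Circle × Circle => if 0 ≤ (p.1 : ℂ).im then F (p.2, p.1.height)
      else F (p.2.neg, p.1.height)
  refine Continuous.if_le (by fun_prop) (by fun_prop) (by fun_prop) (by fun_prop) ?_
  rintro ⟨c, z⟩ h
  rcases Circle.height_eq_of_im_eq_zero h.symm with h | h <;> simp only [h]
  · rw [h0, h0]
  · rw [h1]

end

theorem cross_surjective : Function.Surjective cross := by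
  rintro ⟨c, z⟩
  by_cases h : 0 ≤ (c : ℂ).im
  · exact ⟨(z, c.height), congrArg (smash False antipodal).cls
      (Prod.ext (Circle.upper_height h) rfl)⟩
  · refine ⟨(z.neg, c.height), ?_⟩
    rw [← Circle.height_conj]
    refine Eq.trans ?_ ((smash False antipodal).cls_inv (c, z))
    refine congrArg (smash False antipodal).cls (Prod.ext (Circle.upper_height ?_) rfl)
    rw [Circle.coe_conj, Complex.conj_im]
    linarith

theorem isQuotientMap_cross : IsQuotientMap cross := by
  refine (isQuotientMap_iff _).2 ⟨isCoinducing_iff.2 fun s => ⟨fun hs => ?_, fun hs =>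
    hs.preimage continuous_cross⟩, cross_surjective⟩
  have h : Continuous (crossLift (fun p => cross p ∈ s) ((smash False antipodal).orbit.pt ∈ s)
      (fun a => congrArg (· ∈ s) (cross_zero a)) fun a => congrArg (· ∈ s) (cross_one_neg a)) :=
    continuous_crossLift (isOpen_iff_continuous_mem.1 hs)
  refine isOpen_iff_continuous_mem.2 ?_
  convert h using 1
  funext x
  obtain ⟨p, rfl⟩ := cross_surjective x
  rw [crossLift_cross]

/-- `cross` with a real coordinate. -/
def crossR (a : Circle) (u : ℝ) : (smash False antipodal).Orbit :=
  cross (a, Set.projIcc 0 1 zero_le_one u)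

theorem continuous_crossR {T : Type} [TopologicalSpace T] {a : T → Circle} {u : T → ℝ}
    (ha : Continuous a) (hu : Continuous u) : Continuous fun t => crossR (a t) (u t) :=
  continuous_cross.comp (ha.prodMk (continuous_projIcc.comp hu))

theorem crossR_of_nonpos (a : Circle) {u : ℝ} (h : u ≤ 0) :
    crossR a u = (smash False antipodal).orbit.pt := by
  rw [crossR, Set.projIcc_of_le_left _ h]; exact cross_zero a

theorem crossR_neg_of_one_le (a : Circle) {u : ℝ} (h : 1 ≤ u) : crossR a.neg u = crossR a u := by
  rw [crossR, crossR, Set.projIcc_of_right_le _ h]; exact cross_one_neg a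

/-- The deformation contracting the arc over `1`. -/
def arc (a : Circle) (v h : ℝ) : (smash False antipodal).Orbit :=
  if v ≤ 1 then (if 0 ≤ (a : ℂ).re then crossR a (min v h) else crossR a v)
  else (if 0 ≤ (a : ℂ).re then crossR a h else crossR a.neg (max h (2 - v)))

theorem continuous_arc {T : Type} [TopologicalSpace T] {a : T → Circle} {v h : T → ℝ}
    (ha : Continuous a) (hv : Continuous v) (hh : Continuous h) (hle : ∀ t, h t ≤ 1)
    (h1 : ∀ t, (a t : ℂ).re = 0 → h t = 1) : Continuous fun t => arc (a t) (v t) (h t) := by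
  have hre : Continuous fun t => (a t : ℂ).re := Circle.continuous_re.comp ha
  refine Continuous.if_le ?_ ?_ hv continuous_const ?_
  · refine Continuous.if_le (continuous_crossR ha (hv.min hh)) (continuous_crossR ha hv)
      continuous_const hre ?_
    intro t ht
    rw [h1 t ht.symm, crossR, crossR]
    congr 2
    rcases le_total (v t) 1 with h | h
    · rw [min_eq_left h]
    · rw [min_eq_right h, Set.projIcc_of_right_le _ h, Set.projIcc_right]
  · refine Continuous.if_le (continuous_crossR ha hh)
      (continuous_crossR (Circle.continuous_neg.comp ha) (hh.max (continuous_const.sub hv)))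
      continuous_const hre ?_
    intro t ht
    rw [h1 t ht.symm, crossR_neg_of_one_le _ (le_max_left _ _), crossR, crossR,
      Set.projIcc_right, Set.projIcc_of_right_le _ (le_max_left _ _)]
  · intro t ht
    simp only [ht, min_eq_right (hle t)]
    split_ifs
    · rfl
    · rw [max_eq_right (by linarith [hle t] : h t ≤ 2 - 1)]
      norm_num
      exact (crossR_neg_of_one_le _ le_rfl).symm

theorem arc_zero (a : Circle) (h : ℝ) (hh : 0 ≤ h) :
    arc a 0 h = (smash False antipodal).orbit.pt := by
  rw [arc, if_pos zero_le_one, min_eq_left hh, ite_self, crossR_of_nonpos a le_rfl]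

theorem arc_one_neg (a : Circle) {t h : ℝ} (ht : 0 ≤ t) (hle : h ≤ 1) (hh : 1 - t ≤ h)
    (h1 : (a : ℂ).re = 0 → h = 1) : arc a.neg (1 + t) h = arc a (1 + t) h := by
  wlog ha : 0 ≤ (a : ℂ).re generalizing a
  · have := this a.neg (fun h => h1 (by simpa using h)) (by simp; linarith)
    rw [← this, Circle.neg_neg']
  rcases ht.eq_or_lt with rfl | ht
  · obtain rfl : h = 1 := by linarith
    simp only [arc, add_zero, le_refl, if_true, min_self, ite_self]
    exact crossR_neg_of_one_le _ le_rfl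
  · simp only [arc, if_neg (show ¬1 + t ≤ 1 by linarith), if_pos ha]
    rcases ha.eq_or_lt with h0 | h0
    · obtain rfl := h1 h0.symm
      rw [if_pos (by simp [← h0]), crossR_neg_of_one_le _ le_rfl]
    · rw [if_neg (show ¬0 ≤ (a.neg : ℂ).re by simpa using h0), Circle.neg_neg',
        max_eq_left (by linarith)]

theorem arc_one (v h : ℝ) : arc 1 v h = crossR 1 (if v ≤ 1 then min v h else h) := by
  have h1 : 0 ≤ ((1 : Circle) : ℂ).re := by simp
  rw [arc]
  split_ifs <;> rfl

theorem smash_antipodal_orbit : (smash False antipodal).orbit.HEquiv (MooreP 0) := by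
  let ht (a : Circle) (t : I) : ℝ := max |(a : ℂ).im| (1 - t)
  let G (p : (Circle × I) × I) : (smash False antipodal).Orbit :=
    arc p.1.1 (p.1.2 * (1 + p.2)) (ht p.1.1 p.2)
  have hle : ∀ a t, ht a t ≤ 1 := fun a t => max_le a.abs_im_le_one (by linarith [t.2.1])
  have hnn : ∀ a t, 0 ≤ ht a t := fun a t => (abs_nonneg _).trans (le_max_left _ _)
  have hre : ∀ (a : Circle) t, (a : ℂ).re = 0 → ht a t = 1 := by
    intro a t h
    have h1 := a.re_sq_add_im_sq
    rw [h, ← sq_abs (a : ℂ).im] at h1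
    have : |(a : ℂ).im| = 1 := by nlinarith [abs_nonneg (a : ℂ).im]
    exact le_antisymm (hle a t) (this.ge.trans (le_max_left _ _))
  have hG : Continuous G := continuous_arc (by fun_prop) (by fun_prop) (by fun_prop)
    (fun _ => hle _ _) fun _ => hre _ _
  have hG0 : ∀ a t, G ((a, 0), t) = (smash False antipodal).orbit.pt := by
    intro a t
    show arc a ((0 : ℝ) * _) _ = _
    rw [zero_mul]; exact arc_zero _ _ (hnn _ _)
  have hneg : ∀ (a : Circle) t, ht a.neg t = ht a t := fun a t => by simp [ht]
  have hG1 : ∀ (a : Circle) t, G ((a.neg, 1), t) = G ((a, 1), t) := by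
    intro a t
    show arc a.neg ((1 : ℝ) * _) (ht a.neg t) = arc a ((1 : ℝ) * _) (ht a t)
    rw [one_mul, hneg]
    exact arc_one_neg a t.2.1 (hle _ _) (le_max_right _ _) (hre _ _)
  have hGid : ∀ p, G (p, 0) = cross p := by
    rintro ⟨a, s⟩
    show arc a (s * (1 + (0 : ℝ))) (max _ (1 - (0 : ℝ))) = _
    rw [add_zero, mul_one, sub_zero, max_eq_right a.abs_im_le_one, arc, if_pos s.2.2,
      min_eq_left s.2.2, ite_self, crossR, Set.projIcc_val]
  have hGarc : ∀ s t, ∃ s', G ((1, s), t) = cross (1, s') := by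
    intro s t
    exact ⟨_, arc_one _ _⟩
  have hGarc1 : ∀ s, G ((1, s), 1) = (smash False antipodal).orbit.pt := by
    intro s
    have h : ht 1 1 = 0 := by simp [ht]
    refine (arc_one _ _).trans (crossR_of_nonpos _ ?_)
    rw [h]
    split_ifs
    · exact min_le_right _ _
    · exact le_rfl
  have hsq : (1 : Circle) * 1 = 1 := one_mul 1
  let sq : Circle → Circle := fun z => z * z
  have hin0 : ∀ a, MCone.inl 1 sq (a, 0) = mconePt 1 sq 1 := MCone.inl_zero hsq
  have hin1 : ∀ a : Circle, MCone.inl 1 sq (a.neg, 1) = MCone.inl 1 sq (a, 1) := fun a => by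
    rw [MCone.inl_one, MCone.inl_one]
    exact congrArg _ (Circle.neg_mul_neg' a a)
  let f : (smash False antipodal).Orbit → MCone (1 : Circle) sq :=
    crossLift (MCone.inl 1 sq) (mconePt 1 sq 1) hin0 hin1
  have hf : Continuous f := continuous_crossLift MCone.continuous_inl
  have hfc : ∀ p, f (cross p) = MCone.inl 1 sq p := crossLift_cross
  have hrt : ∀ z : Circle, sq (Function.surjInv Circle.isQuotientMap_mul_self.surjective z) = z :=
    Function.surjInv_eq _
  let g : MCone (1 : Circle) sq → (smash False antipodal).Orbit :=
    MCone.lift (fun p => G (p, 1))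
      (fun z => G ((Function.surjInv Circle.isQuotientMap_mul_self.surjective z, 1), 1))
      (smash False antipodal).orbit.pt (fun a => hG0 a 1) hGarc1 (by
        intro a
        rcases Circle.mul_self_eq_iff.1 (hrt (sq a)) with h | h
        · simp only [h]
        · simp only [h, hG1])
  have hqi : IsQuotientMap (MCone.inl 1 sq) := MCone.isQuotientMap_inl Circle.isQuotientMap_mul_self
  have hg : Continuous g := hqi.continuous_iff.2 (hG.comp (by fun_prop) : Continuous fun p => G (p, 1))
  have hbase : cross (1, 0) = (smash False antipodal).orbit.pt := cross_zero 1
  have hfb : f (smash False antipodal).orbit.pt = mconePt 1 sq 1 := by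
    rw [← hbase, hfc]; exact hin0 1
  have hgb : g (mconePt 1 sq 1) = (smash False antipodal).orbit.pt := by
    rw [← hin0 1]; exact hG0 1 1
  let L (q : (smash False antipodal).Orbit × I) : (smash False antipodal).Orbit :=
    crossLift (fun p => G (p, q.2)) (smash False antipodal).orbit.pt
        (fun a => hG0 a q.2) (fun a => hG1 a q.2) q.1
  have hL : ∀ p t, L (cross p, t) = G (p, t) := fun p t => crossLift_cross p
  let M (q : MCone (1 : Circle) sq × I) : MCone (1 : Circle) sq :=
    MCone.lift (fun p => f (G (p, q.2)))
        (fun z => f (G ((Function.surjInv Circle.isQuotientMap_mul_self.surjective z, 1), q.2)))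
        (mconePt 1 sq 1) (fun a => by rw [hG0, hfb]) (fun s => by
          obtain ⟨s', h⟩ := hGarc s q.2
          rw [h, hfc]
          exact MCone.inl_base (φ := sq) hsq _) (by
        intro a
        rcases Circle.mul_self_eq_iff.1 (hrt (sq a)) with h | h
        · simp only [h]
        · simp only [h, hG1]) q.1
  show PtdHomotopyEquiv _ (MCone (1 : Circle) sq) _ (mconePt 1 sq 1)
  refine ⟨⟨f, hf⟩, ⟨g, hg⟩, hfb, hgb, .symm ?_, .symm ?_⟩
  · refine ContinuousMap.homotopicRel_of L ?_ ?_ ?_ ?_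
    · refine isQuotientMap_cross.continuous_lift_prod_left ?_
      simp only [hL]
      exact hG
    · intro x
      obtain ⟨p, rfl⟩ := cross_surjective x
      rw [hL, hGid]; rfl
    · intro x
      obtain ⟨p, rfl⟩ := cross_surjective x
      rw [hL]
      exact congrArg g (hfc p).symm
    · intro t
      rw [← hbase, hL, hG0, hbase]; rfl
  · refine ContinuousMap.homotopicRel_of M ?_ ?_ ?_ ?_
    · exact hqi.continuous_lift_prod_left (hf.comp hG)
    · intro x
      obtain ⟨p, rfl⟩ := hqi.surjective x
      show f (G (p, 0)) = _
      rw [hGid, hfc]; rfl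
    · intro x
      obtain ⟨p, rfl⟩ := hqi.surjective x
      rfl
    · intro t
      rw [← hin0 1]
      show f (G ((1, 0), t)) = MCone.inl 1 sq (1, 0)
      rw [hG0, hfb, hin0]

end InvSpace

/-! ### Rotating the square -/

namespace Square

/-- The maximum norm of a complex number. -/
def size (p : ℂ) : ℝ := max |p.re| |p.im|

theorem size_nonneg (p : ℂ) : 0 ≤ size p := (abs_nonneg _).trans (le_max_left _ _)

theorem continuous_size : Continuous size := by
  unfold size; fun_prop

theorem size_smul (t : ℝ) (p : ℂ) : size (t • p) = |t| * size p := by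
  simp [size, abs_mul, mul_max_of_nonneg]

@[simp] theorem size_neg (p : ℂ) : size (-p) = size p := by simp [size]

theorem norm_le_size (p : ℂ) : ‖p‖ ≤ 2 * size p := by
  have h1 := Complex.norm_le_abs_re_add_abs_im p
  have h2 : |p.re| ≤ size p := le_max_left _ _
  have h3 : |p.im| ≤ size p := le_max_right _ _
  linarith

theorem size_ne_zero {p : ℂ} (h : p ≠ 0) : size p ≠ 0 := by
  intro h0
  have := norm_le_size p
  rw [h0, mul_zero] at this
  exact h (norm_le_zero_iff.1 this)

/-- Rotation, rescaled to preserve the maximum norm. -/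
def rot (z : Circle) (p : ℂ) : ℂ := (size p / size (z * p)) • ((z : ℂ) * p)

theorem rot_zero (z : Circle) : rot z 0 = 0 := by simp [rot]

theorem size_rot (z : Circle) (p : ℂ) : size (rot z p) = size p := by
  by_cases hp : p = 0
  · rw [hp, rot_zero]
  · have h := size_ne_zero (mul_ne_zero z.coe_ne_zero hp)
    rw [rot, size_smul, abs_of_nonneg (div_nonneg (size_nonneg _) (size_nonneg _)),
      div_mul_cancel₀ _ h]

theorem rot_neg (z : Circle) (p : ℂ) : rot z (-p) = -rot z p := by simp [rot]

theorem neg_rot (z : Circle) (p : ℂ) : rot z.neg p = -rot z p := by simp [rot]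

theorem rot_conj_rot (z : Circle) (p : ℂ) : rot z.conj (rot z p) = p := by
  by_cases hp : p = 0
  · rw [hp, rot_zero, rot_zero]
  · have h := size_ne_zero (mul_ne_zero z.coe_ne_zero hp)
    have h1 := size_ne_zero hp
    have hz : (z.conj : ℂ) * rot z p = (size p / size (z * p)) • p := by
      rw [rot, mul_smul_comm, ← mul_assoc, Circle.coe_conj, ← Complex.normSq_eq_conj_mul_self]
      simp
    rw [rot, size_rot, hz, size_smul, abs_of_nonneg (div_nonneg (size_nonneg _) (size_nonneg _)),
      smul_smul]
    rw [show size p / (size p / size (z * p) * size p) * (size p / size (z * p)) = 1 by field_simp,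
      one_smul]

theorem rot_rot_conj (z : Circle) (p : ℂ) : rot z (rot z.conj p) = p := by
  have := rot_conj_rot z.conj p
  rwa [Circle.conj_conj] at this

theorem continuous_rot : Continuous fun q : Circle × ℂ => rot q.1 q.2 := by
  rw [continuous_iff_continuousAt]
  rintro ⟨z, p⟩
  by_cases hp : p = 0
  · subst hp
    rw [ContinuousAt, rot_zero, tendsto_zero_iff_norm_tendsto_zero]
    have h : Filter.Tendsto (fun q : Circle × ℂ => 2 * size q.2) (𝓝 (z, 0)) (𝓝 0) := by
      have : Continuous fun q : Circle × ℂ => 2 * size q.2 :=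
        continuous_const.mul (continuous_size.comp continuous_snd)
      simpa [size] using this.tendsto (z, 0)
    refine squeeze_zero (fun _ => norm_nonneg _) (fun q => ?_) h
    rw [← size_rot q.1 q.2]
    exact norm_le_size _
  · have h := size_ne_zero (mul_ne_zero z.coe_ne_zero hp)
    have h1 : Continuous fun q : Circle × ℂ => (q.1 : ℂ) * q.2 :=
      (continuous_subtype_val.comp continuous_fst).mul continuous_snd
    have h2 : Continuous fun q : Circle × ℂ => size q.2 := continuous_size.comp continuous_snd
    have h3 : Continuous fun q : Circle × ℂ => size (q.1 * q.2) := continuous_size.comp h1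
    exact (h2.continuousAt.div h3.continuousAt h).smul h1.continuousAt

/-- The interval `[-1, 1]` wrapped around the circle, with endpoints going to `1`. -/
def wrap (s : ℝ) : Circle := (Circle.exp (Real.pi * max (-1) (min 1 s))).neg

@[fun_prop]
theorem continuous_wrap : Continuous wrap := by
  unfold wrap; fun_prop

theorem wrap_neg (s : ℝ) : wrap (-s) = (wrap s).conj := by
  have h : max (-1) (min 1 (-s)) = -max (-1) (min 1 s) := by
    rcases le_total 1 s with h | h <;> rcases le_total s (-1) with h' | h' <;>
      simp [max_def, min_def] <;> split_ifs <;> linarith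
  ext
  simp only [wrap, h, Circle.coe_neg', Circle.coe_conj, Circle.coe_exp, map_neg, ← Complex.exp_conj]
  simp

theorem wrap_of_one_le {s : ℝ} (h : 1 ≤ |s|) : wrap s = 1 := by
  have h1 : wrap 1 = 1 := by
    ext; simp [wrap]
  rcases le_abs'.1 h with h | h
  · rw [← neg_neg s, wrap_neg]
    have : wrap (-s) = wrap 1 := by
      rw [wrap, wrap, min_eq_left (by linarith), min_self]
    rw [this, h1, Circle.conj_one]
  · have : wrap s = wrap 1 := by rw [wrap, wrap, min_eq_left h, min_self]
    rw [this, h1]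

/-- A section of `wrap`. -/
def unwrap (c : Circle) : ℝ := Complex.arg c.neg / Real.pi

theorem abs_unwrap_le (c : Circle) : |unwrap c| ≤ 1 := by
  rw [unwrap, abs_div, abs_of_pos Real.pi_pos, div_le_one Real.pi_pos]
  exact Complex.abs_arg_le_pi _

theorem wrap_unwrap (c : Circle) : wrap (unwrap c) = c := by
  have h := abs_le.1 (abs_unwrap_le c)
  rw [wrap, min_eq_right h.2, max_eq_right h.1, unwrap, mul_div_cancel₀ _ Real.pi_ne_zero,
    Circle.exp_arg, Circle.neg_neg']

theorem unwrap_wrap {s : ℝ} (h : |s| < 1) : unwrap (wrap s) = s := by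
  rw [abs_lt] at h
  have hpi := Real.pi_pos
  rw [unwrap, wrap, Circle.neg_neg', min_eq_right h.2.le, max_eq_right h.1.le,
    Circle.arg_exp (by nlinarith) (by nlinarith), mul_div_cancel_left₀ _ Real.pi_ne_zero]

theorem unwrap_one : unwrap 1 = 1 := by
  simp [unwrap, Complex.arg_neg_one]

theorem isQuotientMap_wrap : IsQuotientMap fun s : Set.Icc (-1 : ℝ) 1 => wrap s :=
  IsQuotientMap.of_surjective_continuous
    (fun c => ⟨⟨unwrap c, abs_le.1 (abs_unwrap_le c)⟩, wrap_unwrap c⟩) (by fun_prop)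

end Square

namespace InvSpace

open Square

section

variable {V : InvSpace}

/-- The double suspension of the orbit space, parametrized by the square. -/
def twoSusp (p : ℂ) (v : V.carrier) : V.orbit.susp.susp.carrier :=
  Susp.point (suspPt _ V.orbit.pt) (Susp.point V.orbit.pt (V.cls v) ((1 + p.re) / 2))
    ((1 + p.im) / 2)

/-- The double smash product with the circle, parametrized by the square. -/
def twoSmash (p : ℂ) (v : V.carrier) : (smash True (smash True V)).Orbit :=
  (smash True (smash True V)).cls (wrap p.re, wrap p.im, v)

theorem continuous_twoSusp : Continuous fun q : ℂ × V.carrier => twoSusp q.1 q.2 := by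
  refine (Susp.continuous_point _).comp (Continuous.prodMk ?_ (by fun_prop))
  exact (Susp.continuous_point _).comp
    ((V.continuous_cls.comp continuous_snd).prodMk (by fun_prop))

theorem continuous_twoSmash : Continuous fun q : ℂ × V.carrier => twoSmash q.1 q.2 := by
  refine (continuous_cls _).comp (f := fun q : ℂ × V.carrier =>
    (wrap q.1.re, wrap q.1.im, q.2)) ?_
  exact Continuous.prodMk (by fun_prop) (Continuous.prodMk (by fun_prop) (by fun_prop))

theorem twoSusp_of_one_le {p : ℂ} (h : 1 ≤ size p) (v : V.carrier) :
    twoSusp p v = V.orbit.susp.susp.pt := by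
  have hre : ∀ u, u ≤ 0 ∨ 1 ≤ u → twoSusp ⟨2 * u - 1, p.im⟩ v = V.orbit.susp.susp.pt := by
    intro u hu
    rw [twoSusp, show (1 + (2 * u - 1)) / 2 = u by ring]
    refine (congrArg (fun x => Susp.point (suspPt _ V.orbit.pt) x _) ?_).trans (Susp.point_base _)
    exact hu.elim (fun hu => Susp.point_of_nonpos _ hu) fun hu => Susp.point_of_one_le _ hu
  rcases le_max_iff.1 h with h | h
  · have := hre ((1 + p.re) / 2) (by
      rcases le_abs'.1 h with h | h
      · left; linarith
      · right; linarith)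
    rwa [show (⟨2 * ((1 + p.re) / 2) - 1, p.im⟩ : ℂ) = p from
      Complex.ext (by ring) rfl] at this
  · rcases le_abs'.1 h with h | h
    · exact Susp.point_of_nonpos _ (by linarith)
    · exact Susp.point_of_one_le _ (by linarith)

theorem twoSmash_of_one_le {p : ℂ} (h : 1 ≤ size p) (v : V.carrier) :
    twoSmash p v = (smash True (smash True V)).orbit.pt := by
  refine (smash True (smash True V)).cls_null (v := (wrap p.re, wrap p.im, v)) ?_
  rcases le_max_iff.1 h with h | h
  · exact Or.inl (wrap_of_one_le h)
  · exact Or.inr ⟨trivial, Or.inl (wrap_of_one_le h)⟩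

theorem twoSusp_null (p : ℂ) {v : V.carrier} (h : v ∈ V.null) :
    twoSusp p v = V.orbit.susp.susp.pt := by
  rw [twoSusp, V.cls_null h, show V.cls V.pt = V.orbit.pt from rfl, Susp.point_base]
  exact Susp.point_base _

theorem twoSmash_null (p : ℂ) {v : V.carrier} (h : v ∈ V.null) :
    twoSmash p v = (smash True (smash True V)).orbit.pt :=
  (smash True (smash True V)).cls_null (v := (wrap p.re, wrap p.im, v))
    (Or.inr ⟨trivial, Or.inr ⟨trivial, h⟩⟩)

theorem twoSusp_inv (p : ℂ) (v : V.carrier) : twoSusp p (V.inv v) = twoSusp p v := by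
  rw [twoSusp, V.cls_inv, twoSusp]

theorem twoSmash_neg_inv (p : ℂ) (v : V.carrier) : twoSmash (-p) (V.inv v) = twoSmash p v := by
  have := (smash True (smash True V)).cls_inv (wrap p.re, wrap p.im, v)
  rw [twoSmash, twoSmash, ← this]
  simp only [Complex.neg_re, Complex.neg_im, wrap_neg]
  rfl

/-- The point of the square parametrizing a pair of points of the circle. -/
def unwrapTwo (c d : Circle) : ℂ := ⟨unwrap c, unwrap d⟩

theorem size_unwrapTwo_of_eq_one {c d : Circle} (h : c = 1 ∨ d = 1) : 1 ≤ size (unwrapTwo c d) := by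
  rcases h with rfl | rfl
  · refine le_trans ?_ (le_max_left _ _)
    simp [unwrapTwo, unwrap_one]
  · refine le_trans ?_ (le_max_right _ _)
    simp [unwrapTwo, unwrap_one]

theorem unwrapTwo_wrap (p : ℂ) :
    unwrapTwo (wrap p.re) (wrap p.im) = p ∨
      (1 ≤ size p ∧ 1 ≤ size (unwrapTwo (wrap p.re) (wrap p.im))) := by
  rcases lt_or_ge (size p) 1 with h | h
  · left
    exact Complex.ext (unwrap_wrap ((le_max_left _ _).trans_lt h))
      (unwrap_wrap ((le_max_right _ _).trans_lt h))
  · right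
    refine ⟨h, size_unwrapTwo_of_eq_one ?_⟩
    exact (le_max_iff.1 h).imp wrap_of_one_le wrap_of_one_le

theorem twoSmash_unwrapTwo (c d : Circle) (v : V.carrier) :
    twoSmash (unwrapTwo c d) v = (smash True (smash True V)).cls (c, d, v) := by
  simp only [twoSmash, unwrapTwo, wrap_unwrap]

theorem twoSusp_coe (v : V.carrier) (u w : I) :
    twoSusp ⟨2 * u - 1, 2 * w - 1⟩ v =
      Quot.mk (SuspRel V.orbit.susp.pt) (Quot.mk (SuspRel V.orbit.pt) (V.cls v, u), w) := by
  rw [twoSusp, show (1 + (2 * (u : ℝ) - 1)) / 2 = u by ring,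
    show (1 + (2 * (w : ℝ) - 1)) / 2 = w by ring]
  exact (Susp.point_coe ..).trans (congrArg (fun x => Quot.mk _ (x, w)) (Susp.point_coe ..))

theorem twoSusp_surjective (x : V.orbit.susp.susp.carrier) : ∃ p v, x = twoSusp p v := by
  obtain ⟨⟨⟨⟨v⟩, u⟩, w⟩⟩ := x
  exact ⟨_, v, (twoSusp_coe v u w).symm⟩

variable {Z : Type} [TopologicalSpace Z] {Φ : ℂ → V.carrier → Z} {z₀ : Z}

theorem exists_lift_twoSmash [LocallyCompactSpace V.carrier]
    (hc : Continuous fun q : ℂ × V.carrier => Φ q.1 q.2) (h1 : ∀ p v, 1 ≤ size p → Φ p v = z₀)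
    (hn : ∀ p, ∀ v ∈ V.null, Φ p v = z₀) (hi : ∀ p v, Φ (-p) (V.inv v) = Φ p v) :
    ∃ f : (smash True (smash True V)).Orbit → Z, Continuous f ∧
      ∀ p v, f (twoSmash p v) = Φ p v := by
  have hw : ∀ p v, Φ (unwrapTwo (wrap p.re) (wrap p.im)) v = Φ p v := by
    intro p v
    rcases unwrapTwo_wrap p with h | ⟨h2, h3⟩
    · rw [h]
    · rw [h1 _ _ h2, h1 _ _ h3]
  let f : (smash True (smash True V)).Orbit → Z :=
    lift (V := smash True (smash True V)) (fun q : Circle × Circle × V.carrier =>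
      Φ (unwrapTwo q.1 q.2.1) q.2.2) z₀
      (by
        rintro ⟨c, d, v⟩
        show Φ (unwrapTwo c.conj d.conj) (V.inv v) = Φ (unwrapTwo c d) v
        have h := hw (-(unwrapTwo c d)) (V.inv v)
        rw [hi, Complex.neg_re, Complex.neg_im, wrap_neg, wrap_neg] at h
        simpa only [unwrapTwo, wrap_unwrap] using h)
      (by
        rintro ⟨c, d, v⟩ (h | ⟨-, h | ⟨-, h⟩⟩)
        · exact h1 _ _ (size_unwrapTwo_of_eq_one (Or.inl h))
        · exact h1 _ _ (size_unwrapTwo_of_eq_one (Or.inr h))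
        · exact hn _ _ h)
  refine ⟨f, continuous_lift ?_, hw⟩
  have q2 := isQuotientMap_prod_id isQuotientMap_wrap V.carrier
  refine isQuotientMap_wrap.continuous_lift_prod_left (Y := Circle × V.carrier)
    (g := fun q : Circle × Circle × V.carrier => Φ (unwrapTwo q.1 q.2.1) q.2.2) ?_
  refine q2.continuous_lift_prod_right (Y := Set.Icc (-1 : ℝ) 1)
    (g := fun q : Set.Icc (-1 : ℝ) 1 × Circle × V.carrier =>
      Φ (unwrapTwo (wrap q.1) q.2.1) q.2.2) ?_
  have : (fun q : Set.Icc (-1 : ℝ) 1 × Set.Icc (-1 : ℝ) 1 × V.carrier =>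
      Φ (unwrapTwo (wrap q.1) (wrap q.2.1)) q.2.2) =
      fun q => Φ (Complex.equivRealProdCLM.symm ((q.1 : ℝ), (q.2.1 : ℝ))) q.2.2 :=
    funext fun q => hw ⟨q.1, q.2.1⟩ _
  rw [this]
  exact hc.comp (f := fun q : Set.Icc (-1 : ℝ) 1 × Set.Icc (-1 : ℝ) 1 × V.carrier =>
    (Complex.equivRealProdCLM.symm ((q.1 : ℝ), (q.2.1 : ℝ)), q.2.2)) (by fun_prop)

theorem one_le_size_mk_left {s t : ℝ} (h : 1 ≤ |s|) : 1 ≤ size ⟨s, t⟩ := h.trans (le_max_left _ _)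

theorem one_le_size_mk_right {s t : ℝ} (h : 1 ≤ |t|) : 1 ≤ size ⟨s, t⟩ := h.trans (le_max_right _ _)

theorem exists_lift_twoSusp
    (hc : Continuous fun q : ℂ × V.carrier => Φ q.1 q.2) (h1 : ∀ p v, 1 ≤ size p → Φ p v = z₀)
    (hn : ∀ p, ∀ v ∈ V.null, Φ p v = z₀) (hi : ∀ p v, Φ p (V.inv v) = Φ p v) :
    ∃ g : V.orbit.susp.susp.carrier → Z, Continuous g ∧ ∀ p v, g (twoSusp p v) = Φ p v := by
  let g₁ : V.orbit.carrier × I × I → Z := fun q =>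
    lift (V := V) (Φ ⟨2 * q.2.1 - 1, 2 * q.2.2 - 1⟩) z₀ (hi _) (hn _) q.1
  have hg₁ : Continuous g₁ := by
    refine (isQuotientMap_quot_mk (r := V.Rel)).continuous_lift_prod_left ?_
    exact hc.comp (f := fun q : V.carrier × I × I =>
      (Complex.equivRealProdCLM.symm (2 * (q.2.1 : ℝ) - 1, 2 * (q.2.2 : ℝ) - 1), q.1))
      (by fun_prop)
  have e1 : ∀ x u w, (u = 0 ∨ u = 1 ∨ w = 0 ∨ w = 1) → g₁ (x, u, w) = z₀ := by
    rintro ⟨v⟩ u w h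
    refine h1 _ v ?_
    rcases h with rfl | rfl | rfl | rfl
    · exact one_le_size_mk_left (by norm_num)
    · exact one_le_size_mk_left (by norm_num)
    · exact one_le_size_mk_right (by norm_num)
    · exact one_le_size_mk_right (by norm_num)
  have e2 : ∀ u w, g₁ (V.orbit.pt, u, w) = z₀ := fun u w => hn _ _ V.pt_mem
  let g₂ : V.orbit.susp.carrier × I → Z := fun q =>
    Susp.lift (x₀ := V.orbit.pt) z₀ (fun y => g₁ (y.1, y.2, q.2)) (fun x => e1 _ _ _ (Or.inl rfl))
      (fun x => e1 _ _ _ (Or.inr (Or.inl rfl))) (fun u => e2 _ _) q.1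
  have hg₂ : Continuous g₂ := by
    refine (isQuotientMap_susp_mk V.orbit.pt).continuous_lift_prod_left ?_
    exact hg₁.comp (f := fun q : (V.orbit.carrier × I) × I => (q.1.1, q.1.2, q.2)) (by fun_prop)
  let g : V.orbit.susp.susp.carrier → Z := Susp.lift (x₀ := V.orbit.susp.pt) z₀ g₂
    (by rintro ⟨x, u⟩; exact e1 _ _ _ (by simp)) (by rintro ⟨x, u⟩; exact e1 _ _ _ (by simp))
    fun u => e2 _ _
  have hg : ∀ (v) (u w : I), g (twoSusp ⟨2 * u - 1, 2 * w - 1⟩ v) = Φ ⟨2 * u - 1, 2 * w - 1⟩ v :=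
    fun v u w => congrArg g (twoSusp_coe v u w)
  refine ⟨g, Susp.continuous_lift hg₂, fun p v => ?_⟩
  rcases lt_or_ge (size p) 1 with h | h
  · have h2 := abs_lt.1 ((le_max_left _ _).trans_lt h)
    have h3 := abs_lt.1 ((le_max_right _ _).trans_lt h)
    have := hg v ⟨(1 + p.re) / 2, by linarith, by linarith⟩ ⟨(1 + p.im) / 2, by linarith, by linarith⟩
    rwa [show (⟨2 * ((1 + p.re) / 2) - 1, 2 * ((1 + p.im) / 2) - 1⟩ : ℂ) = p from
      Complex.ext (by ring) (by ring)] at this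
  · have := hg v 1 1
    have h2 : 1 ≤ size ⟨2 * ((1 : I) : ℝ) - 1, 2 * ((1 : I) : ℝ) - 1⟩ :=
      one_le_size_mk_left (by norm_num)
    rw [twoSusp_of_one_le h2, ← twoSusp_of_one_le h v, h1 _ _ h2] at this
    rw [this, h1 _ _ h]

/-- Smashing twice with the circle is double suspension, for involutions which cover the
antipodal involution of the circle. -/
theorem smash_smash_orbit [LocallyCompactSpace V.carrier] (z : V.carrier → Circle)
    (hz : Continuous z) (hinv : ∀ v, v ∉ V.null → z (V.inv v) = (z v).neg) :
    (smash True (smash True V)).orbit.HEquiv V.orbit.susp.susp := by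
  have hz' : Continuous fun v => (z v).conj := by fun_prop
  obtain ⟨f, hfc, hf⟩ := exists_lift_twoSmash (V := V) (z₀ := V.orbit.susp.susp.pt)
    (Φ := fun p v => twoSusp (rot (z v) p) v)
    (continuous_twoSusp.comp ((continuous_rot.comp
      ((hz.comp continuous_snd).prodMk continuous_fst)).prodMk continuous_snd))
    (fun p v h => twoSusp_of_one_le (by rwa [size_rot]) v) (fun p v h => twoSusp_null _ h)
    (fun p v => by
      rw [twoSusp_inv]
      by_cases h : v ∈ V.null
      · rw [twoSusp_null _ h, twoSusp_null _ h]
      · rw [hinv v h, rot_neg, neg_rot, neg_neg])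
  obtain ⟨g, hgc, hg⟩ := exists_lift_twoSusp (V := V)
    (z₀ := (smash True (smash True V)).orbit.pt)
    (Φ := fun p v => twoSmash (rot (z v).conj p) v)
    (continuous_twoSmash.comp ((continuous_rot.comp
      ((hz'.comp continuous_snd).prodMk continuous_fst)).prodMk continuous_snd))
    (fun p v h => twoSmash_of_one_le (by rwa [size_rot]) v) (fun p v h => twoSmash_null _ h)
    (fun p v => by
      by_cases h : v ∈ V.null
      · rw [← neg_neg (rot _ p), twoSmash_neg_inv, twoSmash_null _ h, twoSmash_null _ h]
      · rw [hinv v h, show (z v).neg.conj = (z v).conj.neg from by ext; simp, neg_rot,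
          twoSmash_neg_inv])
  refine PtdHomotopyEquiv.of_inverse f g hfc hgc ?_ ?_ ?_
  · rw [← twoSmash_null 0 V.pt_mem, hf, twoSusp_null _ V.pt_mem]
  · rintro ⟨c, d, v⟩
    show g (f ((smash True (smash True V)).cls (c, d, v))) = (smash True (smash True V)).cls (c, d, v)
    rw [← twoSmash_unwrapTwo, hf, hg, rot_conj_rot]
  · intro x
    obtain ⟨p, v, rfl⟩ := twoSusp_surjective x
    rw [hg, hf, rot_rot_conj]

end

end InvSpace

/-! ### The summand of weight two -/

theorem continuous_sum_prod {A B Y Z : Type} [TopologicalSpace A] [TopologicalSpace B]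
    [TopologicalSpace Y] [TopologicalSpace Z] {g : (A ⊕ B) × Y → Z}
    (hl : Continuous fun p : A × Y => g (Sum.inl p.1, p.2))
    (hr : Continuous fun p : B × Y => g (Sum.inr p.1, p.2)) : Continuous g := by
  refine (Homeomorph.sumProdDistrib (X := A) (Y := B) (Z := Y)).symm.isQuotientMap.continuous_iff.2 ?_
  exact continuous_sum_dom.2 ⟨hl, hr⟩

namespace Circle

/-- The parametrization of the circle by the suspension of two points. -/
def ofSuspBool : Susp Bool false → Circle :=
  Susp.lift (Z := Circle) 1 (fun p => if p.1 then Square.wrap (2 * p.2 - 1) else 1)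
    (by rintro (_ | _) <;> simp [Square.wrap_of_one_le])
    (by rintro (_ | _)
        · simp
        · simpa using Square.wrap_of_one_le (by norm_num)) (by simp)

theorem susp_bool : PtdHomotopyEquiv (Susp Bool false) (SphP 0).carrier (suspPt _ _) (SphP 0).pt := by
  have hc : CompactSpace (Susp Bool false) := Quot.compactSpace
  have h1 : ofSuspBool (suspPt _ _) = 1 := rfl
  have h2 : ∀ u : I, ofSuspBool (Quot.mk _ (true, u)) = Square.wrap (2 * u - 1) :=
    fun u => rfl
  have h3 : ∀ u : I, (u : ℝ) ∈ Set.Ioo 0 1 →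
      Square.unwrap (Square.wrap (2 * (u : ℝ) - 1)) = 2 * u - 1 :=
    fun u hu => Square.unwrap_wrap (abs_lt.2 ⟨by linarith [hu.1], by linarith [hu.2]⟩)
  have h4 : ∀ u : I, (u : ℝ) ∈ Set.Ioo 0 1 → Square.wrap (2 * (u : ℝ) - 1) ≠ 1 := by
    intro u hu h
    have := h3 u hu
    rw [h, Square.unwrap_one] at this
    linarith [hu.2]
  have key : ∀ x : Susp Bool false, x = suspPt _ _ ∨
      ∃ u : I, (u : ℝ) ∈ Set.Ioo 0 1 ∧ x = Quot.mk _ (true, u) := by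
    rintro ⟨⟨_ | _, u⟩⟩
    · exact Or.inl (Susp.mk_base u)
    · rcases u.2.1.eq_or_lt with h | h
      · left
        rw [show u = 0 from Subtype.ext h.symm]; exact Susp.mk_zero _
      · rcases u.2.2.eq_or_lt with h' | h'
        · left
          rw [show u = 1 from Subtype.ext h']; exact Susp.mk_one _
        · exact Or.inr ⟨u, ⟨h, h'⟩, rfl⟩
  refine PtdHomotopyEquiv.of_bijective (Y := Circle) ofSuspBool ?_ ⟨?_, ?_⟩ h1
  · refine Susp.continuous_lift ?_
    refine continuous_prod_of_discrete_left.2 ?_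
    rintro (_ | _)
    · simpa using continuous_const
    · simp only [if_true]; fun_prop
  · intro x y h
    rcases key x with rfl | ⟨u, hu, rfl⟩ <;> rcases key y with rfl | ⟨v, hv, rfl⟩
    · rfl
    · rw [h1, h2] at h
      exact absurd h.symm (h4 v hv)
    · rw [h1, h2] at h
      exact absurd h (h4 u hu)
    · rw [h2, h2] at h
      have := congrArg Square.unwrap h
      rw [h3 u hu, h3 v hv] at this
      rw [show u = v from Subtype.ext (by linarith)]
  · intro z
    obtain ⟨⟨s, hs⟩, rfl⟩ := Square.isQuotientMap_wrap.surjective z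
    refine ⟨Quot.mk _ (true, ⟨(1 + s) / 2, by linarith [hs.1], by linarith [hs.2]⟩), ?_⟩
    rw [h2]
    exact congrArg Square.wrap (by ring)

end Circle

namespace InvSpace

/-- The disjoint union of the circle, with the antipodal involution, and a null point. -/
def haloed : InvSpace where
  carrier := Circle ⊕ Unit
  inv := Sum.map Circle.neg id
  null := {Sum.inr ()}
  pt := Sum.inr ()
  pt_mem := rfl

theorem smash_smash_haloed :
    (smash True (smash False antipodal)).orbit.HEquiv (smash True (smash True haloed)).orbit := by
  let W := smash True (smash False antipodal)
  let W' := smash True (smash True haloed)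
  let f : W.Orbit → W'.Orbit := lift (V := W)
    (fun q : Circle × Circle × Circle => W'.cls (q.1, q.2.1, Sum.inl q.2.2)) (W'.cls W'.pt)
    (fun q => W'.cls_inv (q.1, q.2.1, Sum.inl q.2.2))
    (fun q hq => W'.cls_null (v := (q.1, q.2.1, Sum.inl q.2.2)) <| by
      obtain ⟨c, d, z⟩ : Circle × Circle × Circle := q
      rcases hq with h | ⟨-, h | ⟨h, -⟩⟩
      · exact Or.inl h
      · exact Or.inr ⟨trivial, Or.inl h⟩
      · exact h.elim)
  let g : W'.Orbit → W.Orbit := lift (V := W')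
    (fun q : Circle × Circle × (Circle ⊕ Unit) =>
      Sum.elim (fun z : Circle => W.cls (q.1, q.2.1, z)) (fun _ => W.cls W.pt) q.2.2) (W.cls W.pt)
    (by
      rintro ⟨c, d, z | z⟩
      · exact W.cls_inv (c, d, z)
      · rfl)
    (by
      rintro ⟨c, d, z | z⟩ hq
      · refine W.cls_null (v := (c, d, z)) ?_
        rcases hq with h | ⟨-, h | ⟨-, h⟩⟩
        · exact Or.inl h
        · exact Or.inr ⟨trivial, Or.inl h⟩
        · exact absurd h Sum.inl_ne_inr
      · rfl)
  refine PtdHomotopyEquiv.of_inverse f g ?_ ?_ ?_ ?_ ?_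
  · refine continuous_lift (W'.continuous_cls.comp
      (f := fun q : Circle × Circle × Circle => (q.1, q.2.1, Sum.inl q.2.2)) ?_)
    have : Continuous fun q : Circle × Circle × Circle =>
      (q.1, q.2.1, (Sum.inl q.2.2 : Circle ⊕ Unit)) := by fun_prop
    exact this
  · refine continuous_lift ?_
    have h : Continuous fun q : (Circle ⊕ Unit) × Circle × Circle =>
        (Sum.elim (fun z : Circle => W.cls (q.2.1, q.2.2, z)) (fun _ => W.cls W.pt) q.1 :
          W.Orbit) := by
      refine continuous_sum_prod ?_ continuous_const
      refine W.continuous_cls.comp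
        (f := fun q : Circle × Circle × Circle => (q.2.1, q.2.2, q.1)) ?_
      have : Continuous fun q : Circle × Circle × Circle => (q.2.1, q.2.2, q.1) := by fun_prop
      exact this
    exact h.comp (f := fun q : Circle × Circle × (Circle ⊕ Unit) => (q.2.2, q.1, q.2.1))
      (by fun_prop)
  · exact W'.cls_null (v := ((1 : Circle), (1 : Circle), Sum.inl (1 : Circle))) (Or.inl rfl)
  · rintro ⟨q⟩; rfl
  · rintro ⟨⟨c, d, z | z⟩⟩
    · rfl
    · have h : f (W.cls W.pt) = W'.cls W'.pt :=
        W'.cls_null (v := ((1 : Circle), (1 : Circle), Sum.inl (1 : Circle))) (Or.inl rfl)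
      exact h.trans (W'.cls_null (v := (c, d, Sum.inr z))
        (Or.inr ⟨trivial, Or.inr ⟨trivial, rfl⟩⟩)).symm

/-- The component of `haloed.orbit` containing a point. -/
def haloedComponent : haloed.Orbit → Bool :=
  lift (V := haloed) (Sum.elim (fun _ : Circle => true) fun _ => false) false
    (by rintro (z | z) <;> rfl) (by rintro _ rfl; rfl)

/-- A pair of points is a retract of `haloed.orbit`. -/
def haloedRetract : CollaredRetract haloed.Rel false where
  i b := haloed.cls (if b then Sum.inl (1 : Circle) else Sum.inr ())
  r := haloedComponent
  ρ q := lift (V := haloed) (fun v : Circle ⊕ Unit => haloed.cls (Sum.map (Circle.flat · q.2) id v))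
    (haloed.cls haloed.pt)
    (by
      rintro (z | z)
      · show haloed.cls (Sum.inl (z.neg.flat q.2)) = haloed.cls (Sum.inl (z.flat q.2))
        rw [Circle.flat_neg]
        exact haloed.cls_inv (Sum.inl (z.flat q.2))
      · rfl)
    (by rintro _ rfl; rfl) q.1
  h := Sum.elim (fun z : Circle => 2 * |(z : ℂ).im|) fun _ => 0
  continuous_i := continuous_of_discreteTopology
  continuous_r := continuous_lift (continuous_sum_dom.2 ⟨continuous_const, continuous_const⟩)
  continuous_ρ := by
    refine (isQuotientMap_quot_mk (r := haloed.Rel)).continuous_lift_prod_left ?_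
    refine continuous_sum_prod (A := Circle) (B := Unit) ?_
      (continuous_const (y := haloed.cls (Sum.inr ())))
    exact haloed.continuous_cls.comp (continuous_inl.comp Circle.continuous_flat)
  continuous_h := continuous_sum_dom.2 ⟨by
    show Continuous fun z : Circle => 2 * |(z : ℂ).im|
    fun_prop, continuous_const⟩
  r_i := by rintro (_ | _) <;> rfl
  ρ_zero := by
    rintro ⟨z | z⟩
    · exact congrArg (fun z => haloed.cls (Sum.inl z)) (Circle.flat_zero z)
    · rfl
  ρ_i := by
    rintro (_ | _) t
    · rfl
    · exact congrArg (fun z => haloed.cls (Sum.inl z)) (Circle.flat_one t)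
  r_ρ := by rintro ⟨z | z⟩ t <;> rfl
  h_rel := by
    rintro (z | z) q (rfl | ⟨h1, h2⟩)
    · left; simp [haloed]
    · exact absurd h1 Sum.inl_ne_inr
    · exact Or.inl rfl
    · subst h2; exact Or.inl rfl
  h_i := by
    let F : haloed.Orbit → ℝ := lift (V := haloed)
      (Sum.elim (fun z : Circle => 2 * |(z : ℂ).im|) fun _ => 0) 0
      (by rintro (z | z) <;> simp [haloed]) (by rintro _ rfl; rfl)
    intro p b h
    left
    have h1 : F (haloed.cls p) = F (haloed.cls (if b then Sum.inl (1 : Circle) else Sum.inr ())) :=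
      congrArg F h
    refine le_of_eq (Eq.trans h1 ?_)
    rcases b with _ | _
    · rfl
    · show 2 * |((1 : Circle) : ℂ).im| = 0
      simp
  ρ_one := by
    rintro (z | z) h
    · replace h : 2 * |(z : ℂ).im| < 1 := h
      show haloed.cls (Sum.inl (z.flat 1)) = haloed.cls (Sum.inl (1 : Circle))
      rcases lt_trichotomy (z : ℂ).re 0 with h1 | h1 | h1
      · rw [Circle.flat_one_right_of_re_neg (by linarith) h1]
        exact haloed.cls_inv (Sum.inl 1)
      · have := z.re_sq_add_im_sq
        rw [h1, ← sq_abs (z : ℂ).im] at this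
        nlinarith [abs_nonneg (z : ℂ).im]
      · rw [Circle.flat_one_right_of_re_pos (by linarith) h1]
    · rfl

theorem haloed_quotient : PtdHomotopyEquiv haloedRetract.Quotient (SphP 0).carrier
    (haloedRetract.q (haloedRetract.i false)) (SphP 0).pt := by
  have : CompactSpace haloed.Orbit := Quot.compactSpace (X := Circle ⊕ Unit)
  have : CompactSpace haloedRetract.Quotient := Quot.compactSpace
  let f : haloed.Orbit → Circle :=
    lift (V := haloed) (Sum.elim (fun z : Circle => z * z) fun _ => 1) 1
      (by rintro (z | z)
          · exact Circle.neg_mul_neg' z z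
          · rfl) (by rintro _ rfl; rfl)
  have hf : Continuous f :=
    continuous_lift (continuous_sum_dom.2
      ⟨Circle.isQuotientMap_mul_self.continuous, continuous_const⟩)
  have hfi : ∀ b, f (haloedRetract.i b) = 1 := by
    rintro (_ | _)
    · rfl
    · exact one_mul _
  have e : haloedRetract.q (haloed.cls (Sum.inl (1 : Circle))) =
      haloedRetract.q (haloed.cls (Sum.inr ())) := haloedRetract.q_i true
  have key : ∀ v : Circle ⊕ Unit, ∃ z : Circle,
      haloedRetract.q (haloed.cls v) = haloedRetract.q (haloed.cls (Sum.inl z)) := by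
    rintro (z | z)
    · exact ⟨z, rfl⟩
    · exact ⟨1, e.symm⟩
  let F : haloedRetract.Quotient → Circle :=
    Quot.lift f (by rintro _ _ ⟨⟨a, rfl⟩, ⟨b, rfl⟩⟩; rw [hfi, hfi])
  refine PtdHomotopyEquiv.of_bijective (Y := Circle) F (continuous_quot_lift _ hf)
    ⟨?_, ?_⟩ rfl
  · rintro ⟨⟨v⟩⟩ ⟨⟨w⟩⟩ h
    obtain ⟨z, hz⟩ := key v
    obtain ⟨z', hz'⟩ := key w
    refine hz.trans (Eq.trans ?_ hz'.symm)
    have h' := ((congrArg F hz).symm.trans h).trans (congrArg F hz')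
    rcases Circle.mul_self_eq_iff.1 h' with rfl | rfl
    · rfl
    · exact congrArg _ (haloed.cls_inv (Sum.inl z'))
  · intro z
    obtain ⟨w, hw⟩ := Circle.exists_mul_self_eq z
    exact ⟨haloedRetract.q (haloed.cls (Sum.inl w)), hw⟩

theorem susp_haloed_orbit : haloed.orbit.susp.HEquiv ((SphP 0).wedge (SphP 1)) :=
  haloedRetract.splitting.trans (Circle.susp_bool.wedge haloed_quotient.susp)

theorem susp_smash_smash_antipodal_orbit :
    (smash True (smash False antipodal)).orbit.susp.HEquiv ((SphP 2).wedge (SphP 3)) := by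
  have : LocallyCompactSpace haloed.carrier :=
    inferInstanceAs (LocallyCompactSpace (Circle ⊕ Unit))
  have h : (smash True (smash True haloed)).orbit.HEquiv haloed.orbit.susp.susp :=
    smash_smash_orbit (Sum.elim id fun _ => 1)
      (continuous_sum_dom.2 ⟨continuous_id, continuous_const⟩) (by
        rintro (z | z) hz
        · rfl
        · exact absurd rfl hz)
  refine (smash_smash_haloed.trans h).susp.trans (susp_haloed_orbit.susp.susp.trans ?_)
  exact (PtdSpace.HEquiv.susp_wedge _ _).susp.trans (PtdSpace.HEquiv.susp_wedge _ _)

end InvSpace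

/-! ### Assembling the summands -/

namespace InvSpace

/-- `V` is locally compact and its involution covers the antipodal involution of the circle. -/
def CoversAntipodal (V : InvSpace) : Prop :=
  LocallyCompactSpace V.carrier ∧
    ∃ z : V.carrier → Circle, Continuous z ∧ ∀ v, z (V.inv v) = (z v).neg

theorem coversAntipodal_antipodal : antipodal.CoversAntipodal :=
  ⟨inferInstanceAs (LocallyCompactSpace Circle), id, continuous_id, fun _ => rfl⟩

theorem CoversAntipodal.smash {V : InvSpace} (h : V.CoversAntipodal) (b : Prop) :
    (smash b V).CoversAntipodal := by
  obtain ⟨h1, z, hz, h2⟩ := h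
  exact ⟨inferInstanceAs (LocallyCompactSpace (Circle × V.carrier)), fun p => z p.2,
    hz.comp continuous_snd, fun p => h2 p.2⟩

theorem CoversAntipodal.smashIter {V : InvSpace} (h : V.CoversAntipodal) (d : ℕ) :
    (smashIter d True V).CoversAntipodal := by
  induction d generalizing V with
  | zero => exact h
  | succ d ih => exact ih (h.smash True)

theorem CoversAntipodal.smash_smash_orbit {V : InvSpace} (h : V.CoversAntipodal) :
    (InvSpace.smash True (InvSpace.smash True V)).orbit.HEquiv V.orbit.susp.susp := by
  obtain ⟨h1, z, hz, h2⟩ := h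
  exact InvSpace.smash_smash_orbit z hz fun v _ => h2 v

/-- The summand of weight `d`. -/
def weightSummand : ℕ → PtdSpace
  | 0 => SphP 1
  | d + 1 => if Even (d + 1) then (SphP (d + 1)).wedge (SphP (d + 2)) else MooreP (d + 1)

theorem susp_susp_weightSummand (d : ℕ) :
    (weightSummand (d + 1)).susp.susp.HEquiv (weightSummand (d + 3)) := by
  have h : Even (d + 2 + 1) ↔ Even (d + 1) := by
    rw [show d + 2 + 1 = d + 1 + 2 by ring, Nat.even_add]; simp
  simp only [weightSummand, h]
  split_ifs
  · exact (PtdSpace.HEquiv.susp_wedge _ _).susp.trans (PtdSpace.HEquiv.susp_wedge _ _)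
  · exact (moore_susp (d + 1)).susp.trans (moore_susp (d + 2))

theorem susp_smashIter_orbit : (d : ℕ) →
    (smashIter d True (smash False antipodal)).orbit.susp.HEquiv (weightSummand (d + 1))
  | 0 => smash_antipodal_orbit.susp.trans (moore_susp 0)
  | 1 => susp_smash_smash_antipodal_orbit
  | d + 2 => by
    rw [smashIter_succ, smashIter_succ]
    exact ((coversAntipodal_antipodal.smash False).smashIter d).smash_smash_orbit.susp.trans
      ((susp_smashIter_orbit d).susp.susp.trans (susp_susp_weightSummand d))

theorem susp_smashIter_antipodal_orbit : (d : ℕ) →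
    (smashIter d False antipodal).orbit.susp.HEquiv (weightSummand d)
  | 0 => antipodal_orbit.susp
  | d + 1 => susp_smashIter_orbit d

namespace CubeIndex

instance finite : (k : ℕ) → Finite (CubeIndex k)
  | 0 => inferInstanceAs (Finite Unit)
  | k + 1 => by
    have := finite k
    exact inferInstanceAs (Finite (CubeIndex k ⊕ CubeIndex k))

/-- The subsets of cardinality `d`, sorted by whether they contain the first element. -/
def fiberEquiv (k d : ℕ) : {j : CubeIndex (k + 1) // j.weight = d} ≃
    {j : CubeIndex k // j.weight = d} ⊕ {j : CubeIndex k // j.weight + 1 = d} :=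
  Equiv.subtypeSum

theorem card_weight (k d : ℕ) : Nat.card {j : CubeIndex k // j.weight = d} = k.choose d := by
  induction k generalizing d with
  | zero =>
    rcases d with _ | d
    · have : Unique {j : CubeIndex 0 // j.weight = 0} :=
        { default := ⟨(), rfl⟩, uniq := fun _ => rfl }
      rw [Nat.card_unique, Nat.choose_zero_right]
    · have : IsEmpty {j : CubeIndex 0 // j.weight = d + 1} := ⟨fun j => (Nat.succ_ne_zero d) j.2.symm⟩
      rw [Nat.card_of_isEmpty, Nat.choose_zero_succ]
  | succ k ih =>
    rw [Nat.card_congr (fiberEquiv k d), Nat.card_sum, ih]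
    rcases d with _ | d
    · simp
    · simp only [Nat.add_right_cancel_iff, ih]
      rw [Nat.choose_succ_succ, add_comm]

end CubeIndex

/-- The weight of an index in the splitting. -/
def splitWeight {n : ℕ} : SplitIndex n → ℕ
  | Sum.inl _ => 0
  | Sum.inr ⟨i, _⟩ => i + 1

theorem splitSummand_eq {n : ℕ} (s : SplitIndex n) :
    SplitSummand n s = weightSummand (splitWeight s) := by
  rcases s with _ | ⟨i, _⟩ <;> rfl

instance (n : ℕ) : Finite (SplitIndex n) :=
  inferInstanceAs (Finite (Unit ⊕ Σ i : Fin (n - 1), Fin ((n - 1).choose (i + 1))))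

theorem card_splitWeight (k d : ℕ) :
    Nat.card {s : SplitIndex (k + 1) // splitWeight s = d} = k.choose d := by
  rcases d with _ | d
  · have : Unique {s : SplitIndex (k + 1) // splitWeight s = 0} :=
      { default := ⟨Sum.inl (), rfl⟩
        uniq := by rintro ⟨_ | ⟨i, _⟩, h⟩
                   · rfl
                   · exact absurd h (Nat.succ_ne_zero _) }
    rw [Nat.card_unique, Nat.choose_zero_right]
  · rcases lt_or_ge d k with hd | hd
    · have e : {s : SplitIndex (k + 1) // splitWeight s = d + 1} ≃ Fin (k.choose (d + 1)) :=
        { toFun := fun s => match s with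
            | ⟨Sum.inr ⟨i, j⟩, h⟩ => Fin.cast (by rw [← h]; rfl) j
            | ⟨Sum.inl _, h⟩ => absurd h.symm (Nat.succ_ne_zero d)
          invFun := fun j => ⟨Sum.inr ⟨⟨d, hd⟩, j⟩, rfl⟩
          left_inv := by
            rintro ⟨_ | ⟨⟨i, hi⟩, j⟩, h⟩
            · exact absurd h.symm (Nat.succ_ne_zero d)
            · obtain rfl : i = d := Nat.succ.inj h
              rfl
          right_inv := fun j => rfl }
      rw [Nat.card_congr e, Nat.card_fin]
    · have : IsEmpty {s : SplitIndex (k + 1) // splitWeight s = d + 1} := by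
        refine ⟨?_⟩
        rintro ⟨_ | ⟨⟨i, hi⟩, j⟩, h⟩
        · exact Nat.succ_ne_zero d h.symm
        · obtain rfl : i = d := Nat.succ.inj h
          rw [Nat.add_sub_cancel] at hi
          omega
      rw [Nat.card_of_isEmpty, Nat.choose_eq_zero_of_lt (by omega)]

theorem exists_equiv_splitIndex (k : ℕ) :
    ∃ e : CubeIndex k ≃ SplitIndex (k + 1), ∀ j, splitWeight (e j) = j.weight := by
  have h : ∀ d, Nonempty ({j : CubeIndex k // j.weight = d} ≃
      {s : SplitIndex (k + 1) // splitWeight s = d}) := fun d =>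
    Finite.card_eq.1 (by rw [CubeIndex.card_weight, card_splitWeight])
  let e := fun d => (h d).some
  refine ⟨(Equiv.sigmaFiberEquiv _).symm.trans
    ((Equiv.sigmaCongrRight e).trans (Equiv.sigmaFiberEquiv _)), fun j => ?_⟩
  exact (e j.weight ⟨j, rfl⟩).2

theorem susp_klein_succ (k : ℕ) :
    PtdHomotopyEquiv (Susp (Klein (k + 1)) (kleinBase (k + 1))) (BigWedge (SplitSummand (k + 1)))
      (suspPt (Klein (k + 1)) (kleinBase (k + 1))) (splitPt (k + 1)) := by
  obtain ⟨e, he⟩ := exists_equiv_splitIndex k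
  have h1 : (PtdSpace.bigWedge (fun j : CubeIndex k => (smashIter j.weight False antipodal).orbit.susp)
      (CubeIndex.bot k)).HEquiv
      (PtdSpace.bigWedge (fun j => SplitSummand (k + 1) (e j)) (CubeIndex.bot k)) := by
    refine PtdSpace.HEquiv.bigWedge (fun j => ?_) _
    rw [splitSummand_eq, he]
    exact susp_smashIter_antipodal_orbit _
  have h2 := PtdSpace.bigWedge_reindex e (SplitSummand (k + 1)) (CubeIndex.bot k) (Sum.inl ())
  have h3 : PtdHomotopyEquiv (Susp (Klein (k + 1)) (kleinBase (k + 1)))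
      (plusIter False k antipodal).orbit.susp.carrier (suspPt _ _)
      (plusIter False k antipodal).orbit.susp.pt := (klein_hEquiv k).susp
  exact h3.trans
    ((susp_orbit_plusIter k False antipodal).trans (h1.trans h2))

end InvSpace

/-- `ΣKₙ ≃ S² ∨ ⋁_{even i>0} (n-1 choose i)(S^{i+1} ∨ S^{i+2})
∨ ⋁_{odd i} (n-1 choose i) M^{i+2}(2)`: the suspension of `Kₙ` is homotopy equivalent
to a wedge of spheres and mod-2 Moore spaces. -/
theorem suspension_klein_splitting (n : ℕ) (hn : 1 ≤ n) :
    PtdHomotopyEquiv (Susp (Klein n) (kleinBase n)) (BigWedge (SplitSummand n))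
      (suspPt (Klein n) (kleinBase n)) (splitPt n) := by
  obtain ⟨k, rfl⟩ := Nat.exists_eq_add_of_le' hn
  exact InvSpace.susp_klein_succ k
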